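/- arXiv:1210.0352 — 3 statements merged into one kernel-verified Lean document; each statement's English description precedes it below -/
import Mathlib

section
/- Choquet's capacitability theorem for cap_p: let p > 1, assume X is locally compact, and assume all functions in N^{1,p}(X) are quasicontinuous. Then every Borel set (and even every Suslin set) A ⊂ int E is capacitable, i.e. cap_p(A,E) = sup { cap_p(K,E) : K compact, K ⊂ A } = inf { cap_p(G,E) : G open, A ⊂ G ⊂ E }. -/
open MeasureTheory Metric Set Filter
open scoped ENNReal NNReal Topology

noncomputable section

variable {X : Type*} [MetricSpace X] [MeasurableSpace X] [BorelSpace X]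

/-- A nonconstant, compact, rectifiable curve in `X`, parameterized by arc length on
`[0, len]`. The arc-length parameterization is expressed by requiring that the length
(total variation) of the curve on each subinterval `[s, t]` equals `t - s`. -/
structure Curve (X : Type*) [MetricSpace X] where
  len : ℝ
  len_pos : 0 < len
  toFun : ℝ → X
  continuousOn : ContinuousOn toFun (Set.Icc 0 len)
  arclength : ∀ s t : ℝ, s ∈ Set.Icc 0 len → t ∈ Set.Icc 0 len → s ≤ t →
    eVariationOn toFun (Set.Icc s t) = ENNReal.ofReal (t - s)
  nonconstant : ∃ s ∈ Set.Icc 0 len, ∃ t ∈ Set.Icc 0 len, toFun s ≠ toFun t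

/-- The curve integral `∫_γ g ds` of a nonnegative function along an arc-length
parameterized curve. -/
def Curve.integral (γ : Curve X) (g : X → ℝ≥0∞) : ℝ≥0∞ :=
  ∫⁻ t in Set.Icc (0 : ℝ) γ.len, g (γ.toFun t)

/-- `|a - b|` with the convention that it is `∞` whenever both `a` and `b` are infinite. -/
def ugDiff (a b : EReal) : ℝ≥0∞ :=
  if a.abs = ⊤ ∨ b.abs = ⊤ then ⊤ else (a - b).abs

/-- The upper gradient inequality for `f` and `g` along the curve `γ`. -/
def UGOn (f : X → EReal) (g : X → ℝ≥0∞) (γ : Curve X) : Prop :=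
  ugDiff (f (γ.toFun 0)) (f (γ.toFun γ.len)) ≤ γ.integral g

/-- A curve family has zero `p`-modulus. -/
def ZeroModulus (p : ℝ) (μ : Measure X) (Γ : Set (Curve X)) : Prop :=
  ∃ ρ : X → ℝ≥0∞, Measurable ρ ∧ (∫⁻ x, ρ x ^ p ∂μ) < ⊤ ∧ ∀ γ ∈ Γ, γ.integral ρ = ⊤

/-- `g` is an upper gradient of `f`. -/
def IsUpperGradient (f : X → EReal) (g : X → ℝ≥0∞) : Prop :=
  Measurable g ∧ ∀ γ : Curve X, UGOn f g γ

/-- `g` is a `p`-weak upper gradient of `f`: the upper gradient inequality holds for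
`p`-almost every curve. -/
def IsWeakUpperGradient (p : ℝ) (μ : Measure X) (f : X → EReal) (g : X → ℝ≥0∞) : Prop :=
  Measurable g ∧ ZeroModulus p μ {γ : Curve X | ¬ UGOn f g γ}

/-- The energy `∫_X g_u^p dμ` of the minimal `p`-weak upper gradient of `u`, expressed as
the infimum of `∫_X g^p dμ` over all `p`-weak upper gradients `g` of `u`
(`= ∞` if `u` has no `p`-weak upper gradient). -/
def gradEnergy (p : ℝ) (μ : Measure X) (u : X → EReal) : ℝ≥0∞ :=
  ⨅ (g : X → ℝ≥0∞) (_ : IsWeakUpperGradient p μ u g), ∫⁻ x, g x ^ p ∂μ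

/-- The Newtonian energy `‖u‖_{N^{1,p}(X)}^p = ∫_X |u|^p dμ + ∫_X g_u^p dμ`. -/
def newtonianEnergy (p : ℝ) (μ : Measure X) (u : X → EReal) : ℝ≥0∞ :=
  (∫⁻ x, (u x).abs ^ p ∂μ) + gradEnergy p μ u

/-- Membership in the Newtonian space `N^{1,p}(X)` (measurability is with respect to the
completion of the Borel σ-algebra, i.e. a.e.-measurability). -/
def MemNewtonian (p : ℝ) (μ : Measure X) (u : X → EReal) : Prop :=
  AEMeasurable u μ ∧ newtonianEnergy p μ u < ⊤

/-- Membership in `N^{1,p}_0(E)`, members being regarded as functions on all of `X`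
that vanish outside `E`. -/
def MemNewtonian0 (p : ℝ) (μ : Measure X) (E : Set X) (u : X → EReal) : Prop :=
  MemNewtonian p μ u ∧ ∀ x ∉ E, u x = 0

/-- The Sobolev capacity `C_p(A)`. -/
def sobolevCapacity (p : ℝ) (μ : Measure X) (A : Set X) : ℝ≥0∞ :=
  ⨅ (u : X → EReal) (_ : MemNewtonian p μ u ∧ ∀ x ∈ A, u x = 1), newtonianEnergy p μ u

/-- The variational capacity `cap_p(A, E)`. -/
def varCapacity (p : ℝ) (μ : Measure X) (A E : Set X) : ℝ≥0∞ :=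
  ⨅ (u : X → EReal) (_ : MemNewtonian0 p μ E u ∧ ∀ x ∈ A, 1 ≤ u x), gradEnergy p μ u

/-- A function is quasicontinuous if outside open sets of arbitrarily small Sobolev
capacity it is real-valued and continuous. -/
def QuasicontinuousFun (p : ℝ) (μ : Measure X) (u : X → EReal) : Prop :=
  ∀ ε : ℝ≥0∞, 0 < ε → ∃ G : Set X, IsOpen G ∧ sobolevCapacity p μ G < ε ∧
    (∀ x ∈ Gᶜ, u x ≠ ⊤ ∧ u x ≠ ⊥) ∧ ContinuousOn u Gᶜ

/-- The capacity `~cap_p(A,E)`: the infimum of `cap_p(G,E)` over all relatively open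
subsets `G` of `E` containing `A`. -/
def varCapacityT (p : ℝ) (μ : Measure X) (A E : Set X) : ℝ≥0∞ :=
  ⨅ (G : Set X) (_ : A ⊆ G ∧ G ⊆ E ∧ ∃ U : Set X, IsOpen U ∧ G = U ∩ E),
    varCapacity p μ G E


set_option linter.unusedSectionVars false

/-- A `p`-weak upper gradient of a real-valued function. -/
def IsRealWeakUG (p : ℝ) (μ : Measure X) (f : X → ℝ) (g : X → ℝ≥0∞) : Prop :=
  Measurable g ∧
    ZeroModulus p μ {γ : Curve X | ¬ edist (f (γ.toFun 0)) (f (γ.toFun γ.len)) ≤ γ.integral g}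

/-- Truncation of extended reals to `[0, 1]`. -/
def unitTrunc (a : EReal) : ℝ := (max 0 (min a 1)).toReal

lemma unitTrunc_coe (x : ℝ) : unitTrunc x = max 0 (min x 1) := by
  have : (max 0 (min (x : EReal) 1)) = ((max 0 (min x 1) : ℝ) : EReal) := by
    rw [EReal.coe_strictMono.monotone.map_max, EReal.coe_strictMono.monotone.map_min]; rfl
  rw [unitTrunc, this, EReal.toReal_coe]

lemma measurable_unitTrunc : Measurable unitTrunc :=
  measurable_ereal_toReal.comp (by fun_prop)

lemma unitTrunc_top : unitTrunc ⊤ = 1 := by simp [unitTrunc]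

lemma unitTrunc_bot : unitTrunc ⊥ = 0 := by simp [unitTrunc]

lemma unitTrunc_mem (a : EReal) : unitTrunc a ∈ Icc (0 : ℝ) 1 := by
  induction a using EReal.rec with
  | bot => simp [unitTrunc_bot]
  | top => simp [unitTrunc_top]
  | coe x => rw [unitTrunc_coe]; constructor <;> simp

lemma unitTrunc_of_one_le {a : EReal} (h : 1 ≤ a) : unitTrunc a = 1 := by
  simp [unitTrunc, h]

lemma unitTrunc_zero : unitTrunc 0 = 0 := by simp [unitTrunc]

lemma ereal_abs_coe (x : ℝ) : (x : EReal).abs = ENNReal.ofReal |x| := rfl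

lemma ofReal_unitTrunc_le (a : EReal) : ENNReal.ofReal (unitTrunc a) ≤ a.abs := by
  induction a using EReal.rec with
  | bot => simp [unitTrunc_bot]
  | top => simp
  | coe x =>
    rw [unitTrunc_coe, ereal_abs_coe]
    apply ENNReal.ofReal_le_ofReal
    have := le_abs_self x
    have := abs_nonneg x
    simp [*]

lemma ugDiff_coe (x y : ℝ) : ugDiff x y = edist x y := by
  rw [ugDiff, if_neg (by simp [ereal_abs_coe]), ← EReal.coe_sub, ereal_abs_coe, edist_dist,
    Real.dist_eq]

lemma edist_unitTrunc_le (a b : EReal) : edist (unitTrunc a) (unitTrunc b) ≤ ugDiff a b := by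
  by_cases h : a.abs = ⊤ ∨ b.abs = ⊤
  · simp [ugDiff, h]
  push Not at h
  induction a using EReal.rec with
  | bot => simp at h
  | top => simp at h
  | coe x =>
    induction b using EReal.rec with
    | bot => simp at h
    | top => simp at h
    | coe y =>
      rw [ugDiff_coe, unitTrunc_coe, unitTrunc_coe, edist_dist, edist_dist]
      apply ENNReal.ofReal_le_ofReal
      rw [Real.dist_eq, Real.dist_eq]
      exact (abs_max_sub_max_le_abs _ _ _).trans (abs_inf_sub_inf_le_abs _ _ _) |>.trans_eq'
        (by rw [max_comm 0, max_comm 0])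

lemma Curve.integral_mono (γ : Curve X) {g h : X → ℝ≥0∞} (H : g ≤ h) :
    γ.integral g ≤ γ.integral h := lintegral_mono fun _ => H _

lemma ZeroModulus.mono {p : ℝ} {μ : Measure X} {Γ Γ' : Set (Curve X)} (h : ZeroModulus p μ Γ')
    (hs : Γ ⊆ Γ') : ZeroModulus p μ Γ := by
  obtain ⟨ρ, h1, h2, h3⟩ := h
  exact ⟨ρ, h1, h2, fun γ hγ => h3 γ (hs hγ)⟩

lemma IsWeakUpperGradient.unitTrunc {p : ℝ} {μ : Measure X} {u : X → EReal} {g : X → ℝ≥0∞}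
    (h : IsWeakUpperGradient p μ u g) : IsRealWeakUG p μ (fun x => unitTrunc (u x)) g :=
  ⟨h.1, h.2.mono fun _ hγ hu => hγ ((edist_unitTrunc_le _ _).trans hu)⟩

lemma IsRealWeakUG.coe {p : ℝ} {μ : Measure X} {f : X → ℝ} {g : X → ℝ≥0∞}
    (h : IsRealWeakUG p μ f g) : IsWeakUpperGradient p μ (fun x => (f x : EReal)) g :=
  ⟨h.1, h.2.mono fun _ hγ hu => hγ (by rw [UGOn, ugDiff_coe]; exact hu)⟩

lemma exists_ne_zero_rpow_mul_le {p : ℝ} (hp : 0 < p) {I δ : ℝ≥0∞} (hI : I ≠ ⊤) (hδ : δ ≠ 0) :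
    ∃ c : ℝ≥0∞, c ≠ 0 ∧ c ^ p * I ≤ δ := by
  refine ⟨(δ / (I + 1)) ^ p⁻¹, ?_, ?_⟩
  · simp only [ne_eq, ENNReal.rpow_eq_zero_iff, inv_pos, hp, and_true, not_or, not_and, not_lt]
    refine ⟨?_, fun _ => (inv_pos.2 hp).le⟩
    exact ENNReal.div_ne_zero.2 ⟨hδ, by finiteness⟩
  · rw [← ENNReal.rpow_mul, inv_mul_cancel₀ hp.ne', ENNReal.rpow_one]
    calc δ / (I + 1) * I ≤ δ / (I + 1) * (I + 1) := by gcongr; exact le_self_add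
      _ ≤ δ := ENNReal.mul_le_of_le_div le_rfl

lemma lintegral_iSup_rpow_le {α : Type*} [MeasurableSpace α] {p : ℝ} (hp : 0 < p) (μ : Measure α)
    {g : ℕ → α → ℝ≥0∞} (hg : ∀ n, Measurable (g n)) :
    ∫⁻ x, (⨆ n, g n x) ^ p ∂μ ≤ ∑' n, ∫⁻ x, g n x ^ p ∂μ := by
  rw [← lintegral_tsum fun n => ((hg n).pow_const p).aemeasurable]
  refine lintegral_mono fun x => ?_
  have : (⨆ n, g n x) ^ p = ⨆ n, g n x ^ p := by
    exact (ENNReal.orderIsoRpow p hp).map_iSup fun n => g n x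
  rw [this]
  exact iSup_le fun n => ENNReal.le_tsum n

lemma ZeroModulus.iUnion {p : ℝ} (hp : 0 < p) {μ : Measure X} {Γ : ℕ → Set (Curve X)}
    (h : ∀ n, ZeroModulus p μ (Γ n)) : ZeroModulus p μ (⋃ n, Γ n) := by
  choose ρ hρ hfin htop using h
  obtain ⟨δ, hδ, hsum⟩ := ENNReal.exists_pos_sum_of_countable' (one_ne_zero) ℕ
  choose c hc0 hc using fun n =>
    exists_ne_zero_rpow_mul_le hp (hfin n).ne (hδ n).ne'
  refine ⟨fun x => ⨆ n, c n * ρ n x, Measurable.iSup fun n => (hρ n).const_mul _, ?_, ?_⟩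
  · refine (lintegral_iSup_rpow_le hp μ fun n => (hρ n).const_mul _).trans_lt
      ((ENNReal.tsum_le_tsum fun n => ?_).trans_lt (hsum.trans ENNReal.one_lt_top))
    simp_rw [ENNReal.mul_rpow_of_nonneg _ _ hp.le]
    rw [lintegral_const_mul _ ((hρ n).pow_const p)]
    exact hc n
  · intro γ hγ
    obtain ⟨n, hn⟩ := mem_iUnion.1 hγ
    have h1 : γ.integral (fun x => c n * ρ n x) ≤ γ.integral (fun x => ⨆ n, c n * ρ n x) :=
      γ.integral_mono fun x => le_iSup (fun n => c n * ρ n x) n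
    have h2 : c n * γ.integral (ρ n) ≤ γ.integral (fun x => c n * ρ n x) :=
      lintegral_const_mul_le _ _
    rw [htop n γ hn, ENNReal.mul_top (hc0 n)] at h2
    exact top_le_iff.1 (h2.trans h1)

lemma ZeroModulus.union {p : ℝ} (hp : 0 < p) {μ : Measure X} {Γ Γ' : Set (Curve X)}
    (h : ZeroModulus p μ Γ) (h' : ZeroModulus p μ Γ') : ZeroModulus p μ (Γ ∪ Γ') := by
  refine (ZeroModulus.iUnion (Γ := fun n => if n = 0 then Γ else Γ') hp fun n => ?_).mono ?_
  · split_ifs <;> assumption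
  · rintro γ (hγ | hγ)
    · exact mem_iUnion.2 ⟨0, by simpa using hγ⟩
    · exact mem_iUnion.2 ⟨1, by simpa using hγ⟩

lemma abs_ciSup_sub_ciSup_le {a b : ℕ → ℝ} {d : ℝ} (ha : BddAbove (range a))
    (hb : BddAbove (range b)) (h : ∀ n, |a n - b n| ≤ d) : |(⨆ n, a n) - ⨆ n, b n| ≤ d := by
  rw [abs_sub_le_iff]
  constructor
  · rw [sub_le_iff_le_add]
    refine ciSup_le fun n => ?_
    have := le_ciSup hb n
    have := (abs_sub_le_iff.1 (h n)).1
    linarith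
  · rw [sub_le_iff_le_add]
    refine ciSup_le fun n => ?_
    have := le_ciSup ha n
    have := (abs_sub_le_iff.1 (h n)).2
    linarith

lemma IsRealWeakUG.iSup {p : ℝ} (hp : 0 < p) {μ : Measure X} {f : ℕ → X → ℝ}
    {g : ℕ → X → ℝ≥0∞} (h : ∀ n, IsRealWeakUG p μ (f n) (g n))
    (hf : ∀ x, BddAbove (range fun n => f n x)) :
    IsRealWeakUG p μ (fun x => ⨆ n, f n x) (fun x => ⨆ n, g n x) := by
  refine ⟨Measurable.iSup fun n => (h n).1, (ZeroModulus.iUnion hp fun n => (h n).2).mono ?_⟩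
  intro γ hγ
  by_contra hcon
  simp only [mem_iUnion, mem_ofPred_eq, not_exists, not_not] at hcon hγ
  refine hγ ?_
  have key : ∀ n, edist (f n (γ.toFun 0)) (f n (γ.toFun γ.len)) ≤
      γ.integral (fun x => ⨆ n, g n x) := fun n =>
    (hcon n).trans (γ.integral_mono fun x => le_iSup (fun n => g n x) n)
  by_cases ht : γ.integral (fun x => ⨆ n, g n x) = ⊤
  · rw [ht]; exact le_top
  rw [edist_dist, ← ENNReal.ofReal_toReal ht, Real.dist_eq]
  refine ENNReal.ofReal_le_ofReal (abs_ciSup_sub_ciSup_le (hf _) (hf _) fun n => ?_)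
  have := key n
  rw [edist_dist, Real.dist_eq] at this
  exact (ENNReal.ofReal_le_iff_le_toReal ht).1 this

lemma IsRealWeakUG.add {p : ℝ} (hp : 0 < p) {μ : Measure X} {f₁ f₂ : X → ℝ}
    {g₁ g₂ : X → ℝ≥0∞} (h₁ : IsRealWeakUG p μ f₁ g₁) (h₂ : IsRealWeakUG p μ f₂ g₂) :
    IsRealWeakUG p μ (fun x => f₁ x + f₂ x) (fun x => g₁ x + g₂ x) := by
  refine ⟨h₁.1.add h₂.1, (h₁.2.union hp h₂.2).mono fun γ hγ => ?_⟩
  by_contra hcon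
  simp only [mem_union, mem_ofPred_eq, not_or, not_not] at hcon hγ
  refine hγ ((edist_add_add_le _ _ _ _).trans ((add_le_add hcon.1 hcon.2).trans ?_))
  exact le_lintegral_add _ _

lemma IsRealWeakUG.const_mul {p : ℝ} {μ : Measure X} {f : X → ℝ} {g : X → ℝ≥0∞}
    (h : IsRealWeakUG p μ f g) (c : ℝ≥0) :
    IsRealWeakUG p μ (fun x => c * f x) (fun x => c * g x) := by
  refine ⟨h.1.const_mul _, h.2.mono fun γ hγ hle => hγ ?_⟩
  calc edist (c * f (γ.toFun 0)) (c * f (γ.toFun γ.len))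
      = c * edist (f (γ.toFun 0)) (f (γ.toFun γ.len)) := by
        rw [edist_dist, edist_dist, Real.dist_eq, Real.dist_eq, ← mul_sub, abs_mul,
          NNReal.abs_eq, ENNReal.ofReal_mul c.coe_nonneg, ENNReal.ofReal_coe_nnreal]
    _ ≤ c * γ.integral g := by gcongr
    _ ≤ _ := lintegral_const_mul_le _ _

lemma IsRealWeakUG.min_one {p : ℝ} {μ : Measure X} {f : X → ℝ} {g : X → ℝ≥0∞}
    (h : IsRealWeakUG p μ f g) : IsRealWeakUG p μ (fun x => min (f x) 1) g := by
  refine ⟨h.1, h.2.mono fun γ hγ hle => hγ (le_trans ?_ hle)⟩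
  rw [edist_dist, edist_dist]
  exact ENNReal.ofReal_le_ofReal (abs_inf_sub_inf_le_abs _ _ _)

/-- Functions with values in `[0, 1]` vanishing outside `E`, with a weak upper gradient. -/
structure IsCompetitor (p : ℝ) (μ : Measure X) (E : Set X) (f : X → ℝ) (g : X → ℝ≥0∞) :
    Prop where
  mem_Icc : ∀ x, f x ∈ Icc (0 : ℝ) 1
  aemeasurable : AEMeasurable f μ
  eq_zero : ∀ x ∉ E, f x = 0
  weakUG : IsRealWeakUG p μ f g

lemma exists_competitor_of_varCapacity_lt {p : ℝ} {μ : Measure X} {A E : Set X} {c : ℝ≥0∞}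
    (h : varCapacity p μ A E < c) : ∃ f g, IsCompetitor p μ E f g ∧ (∀ x ∈ A, f x = 1) ∧
      ∫⁻ x, g x ^ p ∂μ < c := by
  simp only [varCapacity, iInf_lt_iff, gradEnergy] at h
  obtain ⟨u, ⟨⟨hu, hu0⟩, hu1⟩, g, hg, hlt⟩ := h
  refine ⟨fun x => unitTrunc (u x), g, ⟨fun x => unitTrunc_mem _,
    measurable_unitTrunc.comp_aemeasurable hu.1, fun x hx => ?_, hg.unitTrunc⟩,
    fun x hx => unitTrunc_of_one_le (hu1 x hx), hlt⟩
  simp [hu0 x hx, unitTrunc_zero]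

lemma measure_lt_top_of_isBounded {μ : Measure X}
    (hball : ∀ (x : X) (r : ℝ), 0 < r → 0 < μ (Metric.ball x r) ∧ μ (Metric.ball x r) < ⊤)
    {E : Set X} (hE : Bornology.IsBounded E) : μ E < ⊤ := by
  rcases E.eq_empty_or_nonempty with rfl | ⟨x, -⟩
  · simp
  obtain ⟨r, hr0, hr⟩ := hE.subset_ball_lt 0 x
  exact (measure_mono hr).trans_lt (hball x r hr0).2

lemma IsCompetitor.memNewtonian {p : ℝ} (hp : 0 < p) {μ : Measure X} {E : Set X} (hE : μ E < ⊤)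
    {f : X → ℝ} {g : X → ℝ≥0∞} (h : IsCompetitor p μ E f g) (hg : ∫⁻ x, g x ^ p ∂μ < ⊤) :
    MemNewtonian p μ (fun x => (f x : EReal)) := by
  refine ⟨h.aemeasurable.coe_real_ereal, ENNReal.add_lt_top.2 ⟨?_, ?_⟩⟩
  · rw [← measure_toMeasurable] at hE
    calc ∫⁻ x, (f x : EReal).abs ^ p ∂μ
        ≤ ∫⁻ x, (toMeasurable μ E).indicator 1 x ∂μ := by
          refine lintegral_mono fun x => ?_
          by_cases hx : x ∈ E
          · rw [indicator_of_mem (subset_toMeasurable _ _ hx), ereal_abs_coe,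
              abs_of_nonneg (h.mem_Icc x).1]
            exact ENNReal.rpow_le_one (by simpa using (h.mem_Icc x).2) hp.le
          · simp [h.eq_zero x hx, hp]
      _ < ⊤ := by rwa [lintegral_indicator_one (measurableSet_toMeasurable _ _)]
  · exact (iInf₂_le g h.weakUG.coe).trans_lt hg

lemma IsCompetitor.varCapacity_le {p : ℝ} (hp : 0 < p) {μ : Measure X} {A E : Set X}
    (hE : μ E < ⊤) {f : X → ℝ} {g : X → ℝ≥0∞} (h : IsCompetitor p μ E f g)
    (hA : ∀ x ∈ A, f x = 1) : varCapacity p μ A E ≤ ∫⁻ x, g x ^ p ∂μ := by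
  by_cases hg : ∫⁻ x, g x ^ p ∂μ = ⊤
  · rw [hg]; exact le_top
  refine (iInf₂_le (fun x => (f x : EReal)) ⟨⟨h.memNewtonian hp hE (lt_top_iff_ne_top.2 hg),
    fun x hx => by simp [h.eq_zero x hx]⟩, fun x hx => by simp [hA x hx]⟩).trans ?_
  exact iInf₂_le g h.weakUG.coe

lemma exists_unit_function_of_sobolevCapacity_lt {p : ℝ} (hp : 0 < p) {μ : Measure X} {A : Set X}
    {c : ℝ≥0∞} (h : sobolevCapacity p μ A < c) : ∃ (f : X → ℝ) (g : X → ℝ≥0∞),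
      IsCompetitor p μ univ f g ∧ (∀ x ∈ A, f x = 1) ∧
      ∫⁻ x, ENNReal.ofReal (f x) ^ p ∂μ + ∫⁻ x, g x ^ p ∂μ < c := by
  simp only [sobolevCapacity, iInf_lt_iff] at h
  obtain ⟨u, ⟨hu, hu1⟩, hlt⟩ := h
  have : ∃ g, IsWeakUpperGradient p μ u g ∧
      ∫⁻ x, (u x).abs ^ p ∂μ + ∫⁻ x, g x ^ p ∂μ < c := by
    simp only [newtonianEnergy, gradEnergy] at hlt
    rw [ENNReal.add_iInf] at hlt
    simp only [iInf_lt_iff] at hlt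
    obtain ⟨g, hlt⟩ := hlt
    by_cases hg : IsWeakUpperGradient p μ u g
    · exact ⟨g, hg, by simpa [hg] using hlt⟩
    · simp [hg] at hlt
  obtain ⟨g, hg, hlt⟩ := this
  refine ⟨fun x => unitTrunc (u x), g, ⟨fun x => unitTrunc_mem _,
    measurable_unitTrunc.comp_aemeasurable hu.1, fun x hx => absurd (mem_univ x) hx,
    hg.unitTrunc⟩, fun x hx => unitTrunc_of_one_le (hu1 x hx).ge, lt_of_le_of_lt ?_ hlt⟩
  gcongr
  exact ofReal_unitTrunc_le _

/-- The restriction of a curve to a subinterval, reparameterized to start at `0`. -/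
def Curve.restrict (γ : Curve X) (a b : ℝ) (ha : 0 ≤ a) (hab : a < b) (hb : b ≤ γ.len) :
    Curve X where
  len := b - a
  len_pos := sub_pos.2 hab
  toFun t := γ.toFun (a + t)
  continuousOn := γ.continuousOn.comp (by fun_prop) fun t ht =>
    ⟨by linarith [ht.1], by linarith [ht.2]⟩
  arclength s t hs ht hst := by
    have h := eVariationOn.comp_eq_of_monotoneOn γ.toFun (fun t => a + t) (t := Icc s t)
      (fun x _ y _ hxy => by simpa using hxy)
    rw [image_const_add_Icc, γ.arclength _ _ ⟨by linarith [hs.1], by linarith [hs.2]⟩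
      ⟨by linarith [ht.1], by linarith [ht.2]⟩ (by linarith), add_sub_add_left_eq_sub] at h
    exact h
  nonconstant := by
    by_contra! hcon
    have h := γ.arclength a b ⟨ha, hab.le.trans hb⟩ ⟨ha.trans hab.le, hb⟩ hab.le
    rw [eVariationOn.constant_on] at h
    · have : b - a ≤ 0 := ENNReal.ofReal_eq_zero.1 h.symm
      linarith
    · rintro _ ⟨s, hs, rfl⟩ _ ⟨t, ht, rfl⟩
      simpa using hcon (s - a) ⟨by linarith [hs.1], by linarith [hs.2]⟩ (t - a)
        ⟨by linarith [ht.1], by linarith [ht.2]⟩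

lemma Curve.integral_restrict (γ : Curve X) {a b : ℝ} (ha : 0 ≤ a) (hab : a < b)
    (hb : b ≤ γ.len) (g : X → ℝ≥0∞) :
    (γ.restrict a b ha hab hb).integral g = ∫⁻ t in Icc a b, g (γ.toFun t) := by
  have h := (measurePreserving_add_left (volume : Measure ℝ) a).setLIntegral_comp_preimage_emb
    (measurableEmbedding_addLeft a) (fun t => g (γ.toFun t)) (Icc a b)
  rw [preimage_const_add_Icc, sub_self] at h
  exact h

lemma Curve.integral_restrict_le (γ : Curve X) {a b : ℝ} (ha : 0 ≤ a) (hab : a < b)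
    (hb : b ≤ γ.len) (g : X → ℝ≥0∞) :
    (γ.restrict a b ha hab hb).integral g ≤ γ.integral g := by
  rw [integral_restrict]
  exact lintegral_mono_set (Icc_subset_Icc ha hb)

lemma Curve.edist_le (γ : Curve X) {a b : ℝ} (ha : 0 ≤ a) (hab : a ≤ b) (hb : b ≤ γ.len) :
    edist (γ.toFun a) (γ.toFun b) ≤ ENNReal.ofReal (b - a) := by
  rw [← γ.arclength a b ⟨ha, hab.trans hb⟩ ⟨ha.trans hab, hb⟩ hab]
  exact eVariationOn.edist_le _ ⟨le_rfl, hab⟩ ⟨hab, le_rfl⟩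

lemma setLIntegral_Icc_add_Icc (F : ℝ → ℝ≥0∞) {a b c : ℝ} (hab : a ≤ b) (hbc : b ≤ c) :
    ∫⁻ t in Icc a c, F t = (∫⁻ t in Icc a b, F t) + ∫⁻ t in Icc b c, F t := by
  rw [← setLIntegral_congr (Ioc_ae_eq_Icc (a := b) (b := c)),
    ← lintegral_union measurableSet_Ioc, Icc_union_Ioc_eq_Icc hab hbc]
  exact disjoint_left.2 fun x hx hx' => hx'.1.not_ge hx.2

lemma edist_mul_le {a b c d : ℝ} (ha : 0 ≤ a) (hd : d ∈ Icc (0 : ℝ) 1) :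
    edist (a * c) (b * d) ≤ ENNReal.ofReal a * edist c d + edist a b := by
  refine (edist_triangle _ (a * d) _).trans ?_
  simp only [edist_dist, Real.dist_eq]
  rw [← ENNReal.ofReal_mul ha]
  refine add_le_add (ENNReal.ofReal_le_ofReal ?_) (ENNReal.ofReal_le_ofReal ?_)
  · rw [← mul_sub, abs_mul, abs_of_nonneg ha]
  · rw [← sub_mul, abs_mul, abs_of_nonneg hd.1]
    exact mul_le_of_le_one_right (abs_nonneg _) hd.2

/-- A product rule on an interval, for functions controlled by integrals and by length. -/
lemma edist_mul_le_lintegral {h k : ℝ → ℝ} {G H : ℝ → ℝ≥0∞} {L : ℝ≥0} {l : ℝ} (hl : 0 ≤ l)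
    (hh : ∀ a b, 0 ≤ a → a ≤ b → b ≤ l → edist (h a) (h b) ≤ ∫⁻ t in Icc a b, G t)
    (hk : ∀ a b, 0 ≤ a → a ≤ b → b ≤ l → edist (k a) (k b) ≤ L * ENNReal.ofReal (b - a))
    (hk1 : ∀ t, k t ∈ Icc (0 : ℝ) 1) (h0 : ∀ t, 0 ≤ h t) (hH : ∀ t, ENNReal.ofReal (h t) ≤ H t)
    (hG : ∫⁻ t in Icc 0 l, G t ≠ ⊤) :
    edist (h 0 * k 0) (h l * k l) ≤ ∫⁻ t in Icc 0 l, (G t + L * H t) := by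
  have step : ∀ a b, 0 ≤ a → a ≤ b → b ≤ l → edist (h a * k a) (h b * k b) ≤
      (∫⁻ t in Icc a b, (G t + L * H t)) +
        L * ENNReal.ofReal (b - a) * ∫⁻ t in Icc a b, G t := by
    intro a b ha hab hb
    have hconst : ENNReal.ofReal (h a) * ENNReal.ofReal (b - a) ≤
        (∫⁻ t in Icc a b, H t) + ENNReal.ofReal (b - a) * ∫⁻ t in Icc a b, G t := by
      have e1 : ENNReal.ofReal (h a) * ENNReal.ofReal (b - a) =
          ∫⁻ _ in Icc a b, ENNReal.ofReal (h a) := by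
        rw [setLIntegral_const, Real.volume_Icc]
      have e2 : (∫⁻ t in Icc a b, H t) + ENNReal.ofReal (b - a) * ∫⁻ t in Icc a b, G t =
          ∫⁻ t in Icc a b, (H t + ∫⁻ t in Icc a b, G t) := by
        rw [lintegral_add_right _ measurable_const, setLIntegral_const, Real.volume_Icc, mul_comm]
      rw [e1, e2]
      refine setLIntegral_mono' measurableSet_Icc fun t ht => ?_
      have h1 : h a ≤ h t + dist (h a) (h t) := by
        rw [Real.dist_eq]; linarith [le_abs_self (h a - h t)]
      calc ENNReal.ofReal (h a) ≤ ENNReal.ofReal (h t) + edist (h a) (h t) := by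
            rw [edist_dist, ← ENNReal.ofReal_add (h0 t) dist_nonneg]
            exact ENNReal.ofReal_le_ofReal h1
        _ ≤ H t + ∫⁻ t in Icc a b, G t := by
            refine add_le_add (hH t) ((hh a t ha ht.1 (ht.2.trans hb)).trans ?_)
            exact lintegral_mono_set (Icc_subset_Icc le_rfl ht.2)
    calc edist (h a * k a) (h b * k b)
        ≤ ENNReal.ofReal (h a) * edist (k a) (k b) + edist (h a) (h b) :=
          edist_mul_le (h0 a) (hk1 b)
      _ ≤ ENNReal.ofReal (h a) * (L * ENNReal.ofReal (b - a)) + ∫⁻ t in Icc a b, G t := by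
          gcongr
          · exact hk a b ha hab hb
          · exact hh a b ha hab hb
      _ = L * (ENNReal.ofReal (h a) * ENNReal.ofReal (b - a)) + ∫⁻ t in Icc a b, G t := by ring
      _ ≤ L * ((∫⁻ t in Icc a b, H t) + ENNReal.ofReal (b - a) * ∫⁻ t in Icc a b, G t) +
            ∫⁻ t in Icc a b, G t := by gcongr
      _ = ((∫⁻ t in Icc a b, G t) + L * ∫⁻ t in Icc a b, H t) +
            L * ENNReal.ofReal (b - a) * ∫⁻ t in Icc a b, G t := by ring
      _ ≤ _ := by
          gcongr
          exact (add_le_add le_rfl (lintegral_const_mul_le _ _)).trans (le_lintegral_add _ _)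
  have telescope : ∀ n : ℕ, 0 < n → ∀ i ≤ n, edist (h 0 * k 0) (h (i * (l / n)) * k (i * (l / n))) ≤
      (∫⁻ t in Icc 0 (i * (l / n)), (G t + L * H t)) +
        L * ENNReal.ofReal (l / n) * ∫⁻ t in Icc 0 (i * (l / n)), G t := by
    intro n hn i
    induction i with
    | zero => simp
    | succ i ih =>
      intro hi
      have hd : 0 ≤ l / n := by positivity
      have ha : 0 ≤ i * (l / n) := by positivity
      have hab : i * (l / n) ≤ (i + 1 : ℕ) * (l / n) := by
        push_cast; nlinarith
      have hb : (i + 1 : ℕ) * (l / n) ≤ l := by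
        have hn' : (0 : ℝ) < n := by exact_mod_cast hn
        rw [mul_div_assoc', div_le_iff₀ hn', mul_comm]
        gcongr
      have hs := step _ _ ha hab hb
      have hdiff : (i + 1 : ℕ) * (l / n) - i * (l / n) = l / n := by push_cast; ring
      rw [hdiff] at hs
      rw [setLIntegral_Icc_add_Icc _ ha hab, setLIntegral_Icc_add_Icc _ ha hab]
      refine (edist_triangle _ _ _).trans ((add_le_add (ih (by omega)) hs).trans_eq ?_)
      ring
  have lim : Tendsto (fun n : ℕ => (∫⁻ t in Icc 0 l, (G t + L * H t)) +
      L * ENNReal.ofReal (l / n) * ∫⁻ t in Icc 0 l, G t) atTop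
      (𝓝 ((∫⁻ t in Icc 0 l, (G t + L * H t)) + L * ENNReal.ofReal 0 * ∫⁻ t in Icc 0 l, G t)) := by
    refine tendsto_const_nhds.add (ENNReal.Tendsto.mul_const (ENNReal.Tendsto.const_mul
      (ENNReal.tendsto_ofReal (tendsto_const_div_atTop_nhds_zero_nat l)) ?_) (Or.inr hG))
    exact Or.inr ENNReal.coe_ne_top
  simp only [ENNReal.ofReal_zero, mul_zero, zero_mul, add_zero] at lim
  refine ge_of_tendsto lim (eventually_atTop.2 ⟨1, fun n hn => ?_⟩)
  have hn0 : (n : ℝ) ≠ 0 := by positivity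
  have := telescope n hn n le_rfl
  rwa [mul_div_cancel₀ _ hn0] at this

lemma IsRealWeakUG.mul_lipschitz {p : ℝ} (hp : 0 < p) {μ : Measure X} {f : X → ℝ}
    {g : X → ℝ≥0∞} (h : IsRealWeakUG p μ f g) (hg : ∫⁻ x, g x ^ p ∂μ < ⊤) (hf : ∀ x, 0 ≤ f x)
    {H : X → ℝ≥0∞} (hH : Measurable H) (hfH : ∀ x, ENNReal.ofReal (f x) ≤ H x)
    {η : X → ℝ} {L : ℝ≥0} (hη : LipschitzWith L η) (hη1 : ∀ x, η x ∈ Icc (0 : ℝ) 1) :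
    IsRealWeakUG p μ (fun x => f x * η x) (fun x => g x + L * H x) := by
  obtain ⟨ρ, hρ, hρp, hρtop⟩ := h.2
  have h₁ : ZeroModulus p μ {γ : Curve X | γ.integral ρ = ⊤} := ⟨ρ, hρ, hρp, fun γ hγ => hγ⟩
  have h₂ : ZeroModulus p μ {γ : Curve X | γ.integral g = ⊤} := ⟨g, h.1, hg, fun γ hγ => hγ⟩
  refine ⟨h.1.add (hH.const_mul _), (h₁.union hp h₂).mono fun γ hγ => ?_⟩
  by_contra hcon
  simp only [mem_union, mem_ofPred_eq, not_or] at hcon hγ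
  refine hγ (edist_mul_le_lintegral (h := fun t => f (γ.toFun t)) (k := fun t => η (γ.toFun t))
    (G := fun t => g (γ.toFun t)) (H := fun t => H (γ.toFun t)) γ.len_pos.le ?_ ?_
    (fun _ => hη1 _) (fun _ => hf _) (fun _ => hfH _) hcon.2)
  · intro a b ha hab hb
    rcases hab.eq_or_lt with rfl | hab
    · simp
    by_contra hne
    have : (γ.restrict a b ha hab hb).integral ρ = ⊤ := by
      refine hρtop _ ?_
      simp only [mem_ofPred_eq, γ.integral_restrict]
      simpa [Curve.restrict] using hne
    exact hcon.1 (top_le_iff.1 (this.ge.trans (γ.integral_restrict_le ha hab hb ρ)))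
  · intro a b ha hab hb
    exact (hη _ _).trans (by gcongr; exact γ.edist_le ha hab hb)

lemma IsCompetitor.iSup {p : ℝ} (hp : 0 < p) {μ : Measure X} {E : Set X} {f : ℕ → X → ℝ}
    {g : ℕ → X → ℝ≥0∞} (h : ∀ n, IsCompetitor p μ E (f n) (g n)) :
    IsCompetitor p μ E (fun x => ⨆ n, f n x) (fun x => ⨆ n, g n x) where
  mem_Icc x := ⟨Real.iSup_nonneg fun n => ((h n).mem_Icc x).1,
    ciSup_le fun n => ((h n).mem_Icc x).2⟩
  aemeasurable := AEMeasurable.iSup fun n => (h n).aemeasurable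
  eq_zero x hx := by simp [(h _).eq_zero x hx]
  weakUG := IsRealWeakUG.iSup hp (fun n => (h n).weakUG) fun x =>
    ⟨1, by rintro _ ⟨n, rfl⟩; exact ((h n).mem_Icc x).2⟩

lemma IsCompetitor.iSup_eq_one {p : ℝ} {μ : Measure X} {E : Set X} {f : ℕ → X → ℝ}
    {g : ℕ → X → ℝ≥0∞} (h : ∀ n, IsCompetitor p μ E (f n) (g n)) {x : X} {n : ℕ}
    (hn : f n x = 1) : ⨆ n, f n x = 1 :=
  le_antisymm (ciSup_le fun n => ((h n).mem_Icc x).2)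
    (hn.ge.trans (le_ciSup (f := fun n => f n x)
      ⟨1, by rintro _ ⟨n, rfl⟩; exact ((h n).mem_Icc x).2⟩ n))

lemma AEMeasurable.exists_measurable_ge {α : Type*} [MeasurableSpace α] {μ : Measure α}
    {f : α → ℝ≥0∞} (hf : AEMeasurable f μ) :
    ∃ H : α → ℝ≥0∞, Measurable H ∧ f ≤ H ∧ H =ᵐ[μ] f := by
  classical
  obtain ⟨m, hm, hfm⟩ := hf
  let N := toMeasurable μ {x | f x ≠ m x}
  have hN : μ N = 0 := by rw [measure_toMeasurable]; exact hfm
  refine ⟨fun x => if x ∈ N then ⊤ else m x,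
    Measurable.ite (measurableSet_toMeasurable _ _) measurable_const hm, fun x => ?_, ?_⟩
  · by_cases hx : x ∈ N
    · simp [hx]
    · have : f x = m x := by
        by_contra hne
        exact hx (subset_toMeasurable _ _ hne)
      simp [hx, this]
  · filter_upwards [hfm, measure_eq_zero_iff_ae_notMem.1 hN] with x h1 h2
    simp [h2, h1]

/-- Sets of small Sobolev capacity carry competitors with small energy, after a cutoff. -/
lemma exists_competitor_eq_cutoff {p : ℝ} (hp : 1 < p) {μ : Measure X} {E V : Set X} {ε : ℝ≥0∞}
    (hV : sobolevCapacity p μ V < ε) {η : X → ℝ} {L : ℝ≥0} (hη : LipschitzWith L η)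
    (hη1 : ∀ x, η x ∈ Icc (0 : ℝ) 1) (hη0 : ∀ x ∉ E, η x = 0) :
    ∃ w g, IsCompetitor p μ E w g ∧ (∀ x ∈ V, w x = η x) ∧
      ∫⁻ x, g x ^ p ∂μ ≤ 2 ^ (p - 1) * (1 + (L : ℝ≥0∞) ^ p) * ε := by
  have hp0 : 0 < p := by linarith
  obtain ⟨v, g, hv, hv1, hlt⟩ := exists_unit_function_of_sobolevCapacity_lt hp0 hV
  obtain ⟨H, hH, hvH, hHv⟩ := hv.aemeasurable.ennreal_ofReal.exists_measurable_ge
  have hg : ∫⁻ x, g x ^ p ∂μ < ⊤ := lt_top_of_lt (lt_of_le_of_lt le_add_self hlt)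
  refine ⟨fun x => v x * η x, fun x => g x + L * H x,
    ⟨fun x => ⟨mul_nonneg (hv.mem_Icc x).1 (hη1 x).1,
      mul_le_one₀ (hv.mem_Icc x).2 (hη1 x).1 (hη1 x).2⟩,
      hv.aemeasurable.mul hη.continuous.aemeasurable, fun x hx => by simp [hη0 x hx],
      hv.weakUG.mul_lipschitz hp0 hg (fun x => (hv.mem_Icc x).1) hH hvH hη hη1⟩,
    fun x hx => by simp [hv1 x hx], ?_⟩
  have hHp : ∫⁻ x, H x ^ p ∂μ = ∫⁻ x, ENNReal.ofReal (v x) ^ p ∂μ :=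
    lintegral_congr_ae (by filter_upwards [hHv] with x hx using by rw [hx])
  calc ∫⁻ x, (g x + L * H x) ^ p ∂μ
      ≤ ∫⁻ x, 2 ^ (p - 1) * (g x ^ p + (L : ℝ≥0∞) ^ p * H x ^ p) ∂μ := by
        refine lintegral_mono fun x => ?_
        rw [← ENNReal.mul_rpow_of_nonneg _ _ hp0.le]
        exact ENNReal.rpow_add_le_mul_rpow_add_rpow _ _ hp.le
    _ = 2 ^ (p - 1) * (∫⁻ x, g x ^ p ∂μ + (L : ℝ≥0∞) ^ p * ∫⁻ x, H x ^ p ∂μ) := by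
        have m1 : Measurable fun x => g x ^ p := hv.weakUG.1.pow_const p
        have m2 : Measurable fun x => H x ^ p := hH.pow_const p
        have m3 : Measurable fun x => g x ^ p + (L : ℝ≥0∞) ^ p * H x ^ p := m1.add (m2.const_mul _)
        rw [lintegral_const_mul _ m3, lintegral_add_left m1,
          lintegral_const_mul _ m2]
    _ ≤ 2 ^ (p - 1) * ((1 + (L : ℝ≥0∞) ^ p) *
          (∫⁻ x, ENNReal.ofReal (v x) ^ p ∂μ + ∫⁻ x, g x ^ p ∂μ)) := by
        rw [hHp, add_mul, one_mul, mul_add ((L : ℝ≥0∞) ^ p)]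
        gcongr
        · exact le_add_self
        · exact le_self_add
    _ ≤ _ := by
        rw [mul_assoc]
        gcongr

lemma exists_lipschitz_cutoff (E : Set X) {δ : ℝ} (hδ : 0 < δ) :
    ∃ (η : X → ℝ) (L : ℝ≥0), LipschitzWith L η ∧ (∀ x, η x ∈ Icc (0 : ℝ) 1) ∧
      (∀ x ∉ E, η x = 0) ∧ ∀ x ∉ cthickening δ Eᶜ, η x = 1 := by
  refine ⟨fun x => 1 - (thickenedIndicator hδ Eᶜ x : ℝ), δ.toNNReal⁻¹, ?_, fun x => ?_,
    fun x hx => ?_, fun x hx => ?_⟩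
  · intro x y
    rw [edist_sub_left]
    exact lipschitzWith_thickenedIndicator hδ Eᶜ x y
  · have h1 : (thickenedIndicator hδ Eᶜ x : ℝ) ≤ 1 := by
      exact_mod_cast thickenedIndicator_le_one hδ Eᶜ x
    have h0 : 0 ≤ (thickenedIndicator hδ Eᶜ x : ℝ) := NNReal.coe_nonneg _
    exact ⟨by linarith, by linarith⟩
  · simp [thickenedIndicator_one hδ Eᶜ hx]
  · simp [thickenedIndicator_zero hδ Eᶜ fun h => hx (thickening_subset_cthickening _ _ h)]

lemma IsCompetitor.min_one_const_mul {p : ℝ} {μ : Measure X} {E : Set X} {f : X → ℝ}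
    {g : X → ℝ≥0∞} (h : IsCompetitor p μ E f g) (c : ℝ≥0) :
    IsCompetitor p μ E (fun x => min (c * f x) 1) (fun x => c * g x) where
  mem_Icc x := ⟨le_min (mul_nonneg c.2 (h.mem_Icc x).1) zero_le_one, min_le_right _ _⟩
  aemeasurable := (h.aemeasurable.const_mul _).min aemeasurable_const
  eq_zero x hx := by simp [h.eq_zero x hx]
  weakUG := (h.weakUG.const_mul c).min_one

lemma exists_one_lt_rpow_mul_lt {p : ℝ} {I c : ℝ≥0∞} (h : I < c) :
    ∃ a : ℝ≥0, 1 < a ∧ (a : ℝ≥0∞) ^ p * I < c := by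
  have lim : Tendsto (fun a : ℝ≥0 => (a : ℝ≥0∞) ^ p * I) (𝓝[>] 1) (𝓝 ((1 : ℝ≥0) ^ p * I)) := by
    refine ENNReal.Tendsto.mul_const ?_ (Or.inr h.ne_top)
    exact (((ENNReal.continuous_rpow_const.comp ENNReal.continuous_coe).tendsto 1).mono_left
      nhdsWithin_le_nhds)
  simp only [ENNReal.coe_one, ENNReal.one_rpow, one_mul] at lim
  obtain ⟨a, h1, h2⟩ := ((lim.eventually_lt_const h).and self_mem_nhdsWithin).exists
  exact ⟨a, h2, h1⟩

/-- Outer regularity of the variational capacity for subsets of the interior. -/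
theorem exists_isOpen_varCapacity_lt {p : ℝ} (hp : 1 < p) {μ : Measure X}
    (hqc : ∀ u : X → EReal, MemNewtonian p μ u → QuasicontinuousFun p μ u)
    {E : Set X} (hE : μ E < ⊤) {A : Set X} (hA : A ⊆ interior E) {c : ℝ≥0∞}
    (h : varCapacity p μ A E < c) :
    ∃ G, IsOpen G ∧ A ⊆ G ∧ G ⊆ E ∧ varCapacity p μ G E < c := by
  have hp0 : 0 < p := by linarith
  obtain ⟨f, g, hfg, hfA, hgc⟩ := exists_competitor_of_varCapacity_lt h
  obtain ⟨a, ha1, hac⟩ := exists_one_lt_rpow_mul_lt (p := p) hgc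
  have hδ : ∀ k : ℕ, (0 : ℝ) < 1 / (k + 1) := fun k => Nat.one_div_pos_of_nat
  choose η L hηL hη1 hη0 hηone using fun k => exists_lipschitz_cutoff E (hδ k)
  obtain ⟨ε, hε, hεsum⟩ := ENNReal.exists_pos_tsum_mul_lt_of_countable (tsub_pos_of_lt hac).ne'
    (fun k => 2 ^ (p - 1) * (1 + (L k : ℝ≥0∞) ^ p)) fun k => by finiteness
  have hfq := hqc _ (hfg.memNewtonian hp0 hE (lt_top_of_lt hgc))
  choose V hVo hVε _ hVc using fun k => hfq (ε k) (by exact_mod_cast hε k)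
  choose w gw hw hwV hwε using fun k =>
    exists_competitor_eq_cutoff hp (hVε k) (hηL k) (hη1 k) (hη0 k)
  have hU : ∀ k, ∃ U, IsOpen U ∧ {x | 1 < a * f x} ∩ (V k)ᶜ = U ∩ (V k)ᶜ := by
    intro k
    have hcont : ContinuousOn (fun x => a * f x) (V k)ᶜ := by
      refine continuousOn_const.mul ?_
      have := EReal.continuousOn_toReal.comp (hVc k) (fun x _ => by simp)
      exact this
    obtain ⟨U, hUo, hU⟩ := continuousOn_iff'.1 hcont (Ioi 1) isOpen_Ioi
    exact ⟨U, hUo, hU⟩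
  choose U hUo hU using hU
  let F : ℕ → X → ℝ := fun n => Nat.casesOn n (fun x => min (a * f x) 1) w
  let g' : ℕ → X → ℝ≥0∞ := fun n => Nat.casesOn n (fun x => a * g x) gw
  have hF : ∀ n, IsCompetitor p μ E (F n) (g' n) := by
    intro n
    cases n with
    | zero => exact hfg.min_one_const_mul a
    | succ k => exact hw k
  let G : Set X := ⋃ k, (U k ∪ V k) ∩ (cthickening (1 / (k + 1)) Eᶜ)ᶜ
  have hGF : ∀ x ∈ G, ⨆ n, F n x = 1 := by
    intro x hx
    obtain ⟨k, hxUV, hxk⟩ := mem_iUnion.1 hx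
    by_cases hxV : x ∈ V k
    · exact IsCompetitor.iSup_eq_one hF (n := k + 1) ((hwV k x hxV).trans (hηone k x hxk))
    · have hxU : x ∈ U k ∩ (V k)ᶜ := ⟨hxUV.resolve_right hxV, hxV⟩
      rw [← hU k] at hxU
      exact IsCompetitor.iSup_eq_one hF (n := 0) (min_eq_right hxU.1.le)
  refine ⟨G, isOpen_iUnion fun k => ((hUo k).union (hVo k)).inter
    isClosed_cthickening.isOpen_compl, fun x hx => ?_, fun x hx => ?_, ?_⟩
  · have hxE : x ∉ closure Eᶜ := by
      rw [closure_compl]; exact fun h => h (hA hx)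
    rw [closure_eq_iInter_cthickening] at hxE
    simp only [mem_iInter, not_forall] at hxE
    obtain ⟨δ, hδ0, hxδ⟩ := hxE
    obtain ⟨k, hk⟩ := exists_nat_one_div_lt hδ0
    refine mem_iUnion.2 ⟨k, ?_, fun hmem => hxδ (cthickening_mono hk.le _ hmem)⟩
    by_cases hxV : x ∈ V k
    · exact Or.inr hxV
    · have : x ∈ {x | 1 < a * f x} ∩ (V k)ᶜ := ⟨by
        rw [mem_ofPred_eq, hfA x hx, mul_one]; exact_mod_cast ha1, hxV⟩
      rw [hU k] at this
      exact Or.inl this.1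
  · obtain ⟨k, -, hxk⟩ := mem_iUnion.1 hx
    by_contra hxE
    exact hxk (self_subset_cthickening _ hxE)
  · refine ((IsCompetitor.iSup hp0 hF).varCapacity_le hp0 hE hGF).trans_lt
      ((lintegral_iSup_rpow_le hp0 μ fun n => (hF n).weakUG.1).trans_lt ?_)
    rw [tsum_eq_zero_add' ENNReal.summable]
    have e0 : ∫⁻ x, g' 0 x ^ p ∂μ = (a : ℝ≥0∞) ^ p * ∫⁻ x, g x ^ p ∂μ := by
      rw [← lintegral_const_mul _ (hfg.weakUG.1.pow_const p)]
      simp only [← ENNReal.mul_rpow_of_nonneg _ _ hp0.le]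
      rfl
    rw [e0]
    refine (ENNReal.add_lt_add_left hac.ne_top
      ((ENNReal.tsum_le_tsum hwε).trans_lt hεsum)).trans_eq ?_
    exact add_tsub_cancel_of_le hac.le

/-- A quantitative form of strict convexity of `s ↦ s ^ p` on the unit interval. -/
lemma exists_one_sub_rpow_le {p : ℝ} (hp : 1 < p) {δ : ℝ} (hδ : 0 < δ) :
    ∃ C : ℝ≥0, ∀ s ∈ Icc (0 : ℝ) 1,
      (1 - s) ^ p + C * ((s + 1) / 2) ^ p ≤ δ + C * ((s ^ p + 1) / 2) := by
  have hp0 : 0 < p := by linarith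
  let D : ℝ → ℝ := fun s => (s ^ p + 1) / 2 - ((s + 1) / 2) ^ p
  have hDcont : Continuous D :=
    ((Real.continuous_rpow_const hp0.le).add continuous_const).div_const 2 |>.sub
      ((Real.continuous_rpow_const hp0.le).comp (by fun_prop))
  have hDpos : ∀ s ∈ Icc (0 : ℝ) 1, s ≠ 1 → 0 < D s := by
    intro s hs hs1
    have hsc := (strictConvexOn_rpow hp).2
    have := hsc (mem_Ici.2 hs.1) (mem_Ici.2 zero_le_one) hs1 (one_half_pos (α := ℝ))
      (one_half_pos (α := ℝ)) (add_halves (1 : ℝ))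
    simp only [smul_eq_mul, Real.one_rpow] at this
    have e : (1 / 2 * s + 1 / 2 * 1 : ℝ) = (s + 1) / 2 := by ring
    rw [e] at this
    simp only [D]
    linarith
  have hDnonneg : ∀ s ∈ Icc (0 : ℝ) 1, 0 ≤ D s := by
    intro s hs
    rcases eq_or_ne s 1 with rfl | h
    · simp [D]
    · exact (hDpos s hs h).le
  let S : Set ℝ := Icc 0 1 ∩ {s | δ ≤ (1 - s) ^ p}
  have hcont : Continuous fun s : ℝ => (1 - s) ^ p :=
    (Real.continuous_rpow_const hp0.le).comp (by fun_prop)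
  have hS : IsCompact S := isCompact_Icc.inter_right (isClosed_le continuous_const hcont)
  rcases S.eq_empty_or_nonempty with hSe | hSn
  · refine ⟨0, fun s hs => ?_⟩
    have : s ∉ S := by simp [hSe]
    have : (1 - s) ^ p < δ := not_le.1 fun h => this ⟨hs, h⟩
    simpa using this.le
  · obtain ⟨s₀, hs₀, hmin⟩ := hS.exists_isMinOn hSn hDcont.continuousOn
    have hD0 : 0 < D s₀ := by
      refine hDpos s₀ hs₀.1 ?_
      rintro rfl
      have := hs₀.2
      simp [hp0.ne'] at this
      linarith
    refine ⟨(1 / D s₀).toNNReal, fun s hs => ?_⟩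
    rw [Real.coe_toNNReal _ (by positivity)]
    have key : (1 - s) ^ p ≤ δ + 1 / D s₀ * D s := by
      by_cases hsS : s ∈ S
      · have h1 : (1 - s) ^ p ≤ 1 :=
          Real.rpow_le_one (by linarith [hs.2]) (by linarith [hs.1]) hp0.le
        have h2 : 1 ≤ 1 / D s₀ * D s := by
          rw [one_div, inv_mul_eq_div, one_le_div hD0]
          exact hmin hsS
        linarith
      · have h1 : (1 - s) ^ p < δ := not_le.1 fun h => hsS ⟨hs, h⟩
        have h2 : 0 ≤ 1 / D s₀ * D s := mul_nonneg (by positivity) (hDnonneg s hs)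
        linarith
    simp only [D] at key ⊢
    linarith [mul_sub (1 / D s₀) ((s ^ p + 1) / 2) (((s + 1) / 2) ^ p)]

lemma exists_tsub_rpow_le {p : ℝ} (hp : 1 < p) {δ : ℝ≥0} (hδ : 0 < δ) :
    ∃ C : ℝ≥0, ∀ a b : ℝ≥0∞, (b - a) ^ p + C * ((a + b) / 2) ^ p ≤
      δ * (a ^ p + b ^ p) + C * ((a ^ p + b ^ p) / 2) := by
  have hp0 : 0 < p := by linarith
  obtain ⟨C, hC⟩ := exists_one_sub_rpow_le hp (δ := δ) (by exact_mod_cast hδ)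
  refine ⟨C, fun a b => ?_⟩
  have hδ' : (δ : ℝ≥0∞) ≠ 0 := by exact_mod_cast hδ.ne'
  rcases eq_or_ne a ⊤ with rfl | ha
  · simp [ENNReal.top_rpow_of_pos hp0, ENNReal.mul_top hδ']
  rcases eq_or_ne b ⊤ with rfl | hb
  · simp [ENNReal.top_rpow_of_pos hp0, ENNReal.mul_top hδ']
  rcases le_total b a with hba | hab
  · rw [tsub_eq_zero_of_le hba, ENNReal.zero_rpow_of_pos hp0, zero_add]
    refine le_add_left ?_
    gcongr
    have h := ENNReal.rpow_arith_mean_le_arith_mean2_rpow (1 / 2) (1 / 2) a b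
      (by rw [ENNReal.add_halves]) hp.le
    rw [← mul_add, ← mul_add, one_div, mul_comm, mul_comm 2⁻¹] at h
    exact h
  rcases eq_or_ne b 0 with rfl | hb0
  · simp [le_zero_iff.1 hab, hp0]
  lift a to ℝ≥0 using ha
  lift b to ℝ≥0 using hb
  have hab' : a ≤ b := by exact_mod_cast hab
  have hb0' : 0 < b := pos_iff_ne_zero.2 (by exact_mod_cast hb0)
  have h2 : (2 : ℝ≥0∞) = ((2 : ℝ≥0) : ℝ≥0∞) := rfl
  rw [h2]
  simp only [← ENNReal.coe_sub, ← ENNReal.coe_add, ← ENNReal.coe_rpow_of_nonneg _ hp0.le,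
    ← ENNReal.coe_div two_ne_zero, ← ENNReal.coe_mul, ENNReal.coe_le_coe]
  rw [← NNReal.coe_le_coe]
  push_cast [NNReal.coe_sub hab']
  have hbR : (0 : ℝ) < b := by exact_mod_cast hb0'
  have haR : (0 : ℝ) ≤ a := a.2
  have habR : (a : ℝ) ≤ b := by exact_mod_cast hab'
  have hs : (a : ℝ) / b ∈ Icc (0 : ℝ) 1 := ⟨by positivity, (div_le_one hbR).2 habR⟩
  have h := mul_le_mul_of_nonneg_right (hC _ hs) (Real.rpow_nonneg hbR.le p)
  have e1 : (1 - (a : ℝ) / b) ^ p * (b : ℝ) ^ p = ((b : ℝ) - a) ^ p := by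
    rw [← Real.mul_rpow (by linarith [hs.2]) hbR.le]
    congr 1; field_simp
  have e2 : (((a : ℝ) / b + 1) / 2) ^ p * (b : ℝ) ^ p = (((a : ℝ) + b) / 2) ^ p := by
    rw [← Real.mul_rpow (by positivity) hbR.le]
    congr 1; field_simp
  have e3 : ((a : ℝ) / b) ^ p * (b : ℝ) ^ p = (a : ℝ) ^ p := by
    rw [← Real.mul_rpow (by positivity) hbR.le]
    congr 1; field_simp
  have hapos : 0 ≤ (a : ℝ) ^ p := Real.rpow_nonneg haR p
  have hd : (0 : ℝ) ≤ δ := δ.2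
  calc ((b : ℝ) - a) ^ p + C * (((a : ℝ) + b) / 2) ^ p
      = ((1 - (a : ℝ) / b) ^ p + C * (((a : ℝ) / b + 1) / 2) ^ p) * (b : ℝ) ^ p := by
        rw [add_mul, mul_assoc, e1, e2]
    _ ≤ (δ + C * ((((a : ℝ) / b) ^ p + 1) / 2)) * (b : ℝ) ^ p := h
    _ = δ * (b : ℝ) ^ p + C * (((a : ℝ) ^ p + (b : ℝ) ^ p) / 2) := by
        rw [← e3]; ring
    _ ≤ _ := by
        gcongr
        linarith

lemma lintegral_tsub_rpow_le {α : Type*} [MeasurableSpace α] {μ : Measure α} {p : ℝ}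
    {δ C : ℝ≥0} {g₁ g₂ : α → ℝ≥0∞} (h₁ : Measurable g₁) (h₂ : Measurable g₂)
    (hC : ∀ a b : ℝ≥0∞, (b - a) ^ p + C * ((a + b) / 2) ^ p ≤
      δ * (a ^ p + b ^ p) + C * ((a ^ p + b ^ p) / 2)) :
    ∫⁻ x, (g₂ x - g₁ x) ^ p ∂μ + C * ∫⁻ x, ((g₁ x + g₂ x) / 2) ^ p ∂μ ≤
      δ * (∫⁻ x, g₁ x ^ p ∂μ + ∫⁻ x, g₂ x ^ p ∂μ) +
        C * ((∫⁻ x, g₁ x ^ p ∂μ + ∫⁻ x, g₂ x ^ p ∂μ) / 2) := by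
  have m₁ : Measurable fun x => g₁ x ^ p := h₁.pow_const p
  have m₂ : Measurable fun x => g₂ x ^ p := h₂.pow_const p
  have m₃ : Measurable fun x => (g₂ x - g₁ x) ^ p := (h₂.sub h₁).pow_const p
  have m₄ : Measurable fun x => ((g₁ x + g₂ x) / 2) ^ p := ((h₁.add h₂).div_const 2).pow_const p
  have m₅ : Measurable fun x => g₁ x ^ p + g₂ x ^ p := m₁.add m₂
  have m₆ : Measurable fun x => (g₁ x ^ p + g₂ x ^ p) / 2 := m₅.div_const 2
  have e : ∫⁻ x, (g₁ x ^ p + g₂ x ^ p) / 2 ∂μ = (∫⁻ x, g₁ x ^ p ∂μ + ∫⁻ x, g₂ x ^ p ∂μ) / 2 := by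
    simp only [div_eq_mul_inv]
    rw [lintegral_mul_const _ m₅, lintegral_add_left m₁]
  rw [← e, ← lintegral_const_mul _ m₄, ← lintegral_const_mul _ m₆, ← lintegral_add_left m₁,
    ← lintegral_const_mul _ m₅, ← lintegral_add_left m₃, ← lintegral_add_left (m₅.const_mul _)]
  exact lintegral_mono fun x => hC _ _

/-- Minkowski's inequality for countable sums. -/
lemma lintegral_tsum_rpow_rpow_le {α : Type*} [MeasurableSpace α] {μ : Measure α} {p : ℝ}
    (hp : 1 ≤ p) {d : ℕ → α → ℝ≥0∞} (hd : ∀ n, Measurable (d n)) :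
    (∫⁻ x, (∑' n, d n x) ^ p ∂μ) ^ (1 / p) ≤ ∑' n, (∫⁻ x, d n x ^ p ∂μ) ^ (1 / p) := by
  have hp0 : 0 < p := by linarith
  have hfin : ∀ N : ℕ, (∫⁻ x, (∑ n ∈ Finset.range N, d n x) ^ p ∂μ) ^ (1 / p) ≤
      ∑ n ∈ Finset.range N, (∫⁻ x, d n x ^ p ∂μ) ^ (1 / p) := by
    intro N
    induction N with
    | zero => simp [hp0]
    | succ N ih =>
      simp only [Finset.sum_range_succ]
      refine (ENNReal.lintegral_Lp_add_le (f := fun x => ∑ n ∈ Finset.range N, d n x)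
        (Finset.measurable_fun_sum _ fun n _ => hd n).aemeasurable (hd N).aemeasurable hp).trans ?_
      gcongr
  have hsup : ∀ x, (∑' n, d n x) ^ p = ⨆ N : ℕ, (∑ n ∈ Finset.range N, d n x) ^ p := by
    intro x
    rw [ENNReal.tsum_eq_iSup_nat]
    exact (ENNReal.orderIsoRpow p hp0).map_iSup fun N => ∑ n ∈ Finset.range N, d n x
  simp only [hsup]
  rw [lintegral_iSup (fun N => (Finset.measurable_fun_sum _ fun n _ => hd n).pow_const p)]
  · have e : (⨆ N : ℕ, ∫⁻ x, (∑ n ∈ Finset.range N, d n x) ^ p ∂μ) ^ (1 / p) =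
        ⨆ N : ℕ, (∫⁻ x, (∑ n ∈ Finset.range N, d n x) ^ p ∂μ) ^ (1 / p) :=
      (ENNReal.orderIsoRpow (1 / p) (by positivity)).map_iSup fun N : ℕ =>
        ∫⁻ x, (∑ n ∈ Finset.range N, d n x) ^ p ∂μ
    rw [e]
    exact iSup_le fun N => (hfin N).trans (ENNReal.sum_le_tsum _)
  · intro M N hMN x
    dsimp only
    gcongr

lemma IsCompetitor.midpoint {p : ℝ} (hp : 0 < p) {μ : Measure X} {E : Set X} {f₁ f₂ : X → ℝ}
    {g₁ g₂ : X → ℝ≥0∞} (h₁ : IsCompetitor p μ E f₁ g₁) (h₂ : IsCompetitor p μ E f₂ g₂) :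
    IsCompetitor p μ E (fun x => (f₁ x + f₂ x) / 2) (fun x => (g₁ x + g₂ x) / 2) where
  mem_Icc x := ⟨by linarith [(h₁.mem_Icc x).1, (h₂.mem_Icc x).1],
    by linarith [(h₁.mem_Icc x).2, (h₂.mem_Icc x).2]⟩
  aemeasurable := (h₁.aemeasurable.add h₂.aemeasurable).div_const 2
  eq_zero x hx := by simp [h₁.eq_zero x hx, h₂.eq_zero x hx]
  weakUG := by
    have h := (h₁.weakUG.add hp h₂.weakUG).const_mul 2⁻¹
    convert h using 2
    · rw [div_eq_inv_mul]; simp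
    · rw [ENNReal.div_eq_inv_mul, ENNReal.coe_inv two_ne_zero]; rfl

lemma varCapacity_mono {p : ℝ} {μ : Measure X} {A B E : Set X} (h : A ⊆ B) :
    varCapacity p μ A E ≤ varCapacity p μ B E :=
  le_iInf₂ fun u hu => iInf₂_le u ⟨hu.1, fun x hx => hu.2 x (h hx)⟩

lemma iSup_le_add_tsum_tsub (a : ℕ → ℝ≥0∞) : ⨆ n, a n ≤ a 0 + ∑' n, (a (n + 1) - a n) := by
  refine iSup_le fun n => ?_
  have : a n ≤ a 0 + ∑ k ∈ Finset.range n, (a (k + 1) - a k) := by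
    induction n with
    | zero => simp
    | succ n ih =>
      rw [Finset.sum_range_succ, ← add_assoc]
      exact le_add_tsub.trans (by gcongr)
  exact this.trans (by gcongr; exact ENNReal.sum_le_tsum _)

/-- The gradients of almost optimal competitors for an increasing sequence of sets are
almost increasing in `L^p`. -/
lemma eventually_lintegral_tsub_rpow_le {p : ℝ} (hp : 1 < p) {μ : Measure X} {E : Set X}
    (hE : μ E < ⊤) {A : ℕ → Set X} (hA : Monotone A) {f : ℕ → X → ℝ} {g : ℕ → X → ℝ≥0∞}
    {t : ℝ≥0∞} (ht : ⨆ n, varCapacity p μ (A n) E = t) (htop : t ≠ ⊤)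
    (hfg : ∀ n, IsCompetitor p μ E (f n) (g n)) (hf : ∀ n, ∀ x ∈ A n, f n x = 1)
    (hg : ∀ n : ℕ, ∫⁻ x, g n x ^ p ∂μ ≤ t + ((n : ℝ≥0∞) + 1)⁻¹) {ε : ℝ≥0∞} (hε : ε ≠ 0) :
    ∀ᶠ i in atTop, ∀ j ≥ i, ∫⁻ x, (g j x - g i x) ^ p ∂μ ≤ ε := by
  have hp0 : 0 < p := by linarith
  obtain ⟨δ, hδ, hδε⟩ : ∃ δ : ℝ≥0, 0 < δ ∧ (δ : ℝ≥0∞) * (2 * (t + 1)) ≤ ε / 2 := by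
    obtain ⟨δ, hδ, h⟩ := ENNReal.exists_pos_tsum_mul_lt_of_countable
      (ENNReal.half_pos hε).ne' (ι := Unit) (fun _ => 2 * (t + 1)) fun _ => by finiteness
    refine ⟨δ (), hδ (), ?_⟩
    rw [tsum_fintype, Finset.univ_unique, Finset.sum_singleton] at h
    rw [mul_comm]
    exact h.le
  obtain ⟨C, hC⟩ := exists_tsub_rpow_le hp hδ
  have hcap : Tendsto (fun n => varCapacity p μ (A n) E) atTop (𝓝 t) := by
    rw [← ht]; exact tendsto_atTop_iSup fun m n h => varCapacity_mono (hA h)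
  have lim1 : Tendsto (fun n : ℕ => (C : ℝ≥0∞) * (t + ((n : ℝ≥0∞) + 1)⁻¹)) atTop (𝓝 (C * t)) := by
    have h0 : Tendsto (fun n : ℕ => ((n : ℝ≥0∞) + 1)⁻¹) atTop (𝓝 0) := by
      have := (tendsto_add_atTop_iff_nat 1).2 ENNReal.tendsto_inv_nat_nhds_zero
      simpa using this
    have := ENNReal.Tendsto.const_mul (tendsto_const_nhds (x := t) |>.add h0)
      (Or.inr (ENNReal.coe_ne_top (r := C)))
    simpa using this
  have lim2 : Tendsto (fun n => (C : ℝ≥0∞) * varCapacity p μ (A n) E + ε / 2) atTop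
      (𝓝 (C * t + ε / 2)) :=
    (ENNReal.Tendsto.const_mul hcap (Or.inr ENNReal.coe_ne_top)).add tendsto_const_nhds
  have hlt : (C : ℝ≥0∞) * t < C * t + ε / 2 :=
    ENNReal.lt_add_right (by finiteness) (ENNReal.half_pos hε).ne'
  filter_upwards [lim1.eventually_lt lim2 hlt] with i hi j hij
  have hle : ∀ k ≥ i, ∫⁻ x, g k x ^ p ∂μ ≤ t + ((i : ℝ≥0∞) + 1)⁻¹ := fun k hk =>
    (hg k).trans (by gcongr)
  have hle1 : t + ((i : ℝ≥0∞) + 1)⁻¹ ≤ t + 1 := by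
    gcongr
    exact ENNReal.inv_le_one.2 le_add_self
  have hmid : varCapacity p μ (A i) E ≤ ∫⁻ x, ((g i x + g j x) / 2) ^ p ∂μ :=
    ((hfg i).midpoint hp0 (hfg j)).varCapacity_le hp0 hE fun x hx => by
      rw [hf i x hx, hf j x (hA hij hx)]; norm_num
  have hmain := lintegral_tsub_rpow_le (μ := μ) (hfg i).weakUG.1 (hfg j).weakUG.1 hC
  have hci : (C : ℝ≥0∞) * varCapacity p μ (A i) E ≠ ⊤ := by
    have : varCapacity p μ (A i) E ≤ t := ht ▸ le_iSup (fun n => varCapacity p μ (A n) E) i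
    exact ENNReal.mul_ne_top ENNReal.coe_ne_top (ne_top_of_le_ne_top htop this)
  rw [← ENNReal.add_le_add_iff_right hci]
  calc ∫⁻ x, (g j x - g i x) ^ p ∂μ + C * varCapacity p μ (A i) E
      ≤ ∫⁻ x, (g j x - g i x) ^ p ∂μ + C * ∫⁻ x, ((g i x + g j x) / 2) ^ p ∂μ := by gcongr
    _ ≤ _ := hmain
    _ ≤ δ * ((t + 1) + (t + 1)) +
          C * (((t + ((i : ℝ≥0∞) + 1)⁻¹) + (t + ((i : ℝ≥0∞) + 1)⁻¹)) / 2) := by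
        gcongr
        · exact (hle i le_rfl).trans hle1
        · exact (hle j hij).trans hle1
        · exact hle i le_rfl
        · exact hle j hij
    _ = δ * (2 * (t + 1)) + C * (t + ((i : ℝ≥0∞) + 1)⁻¹) := by
        rw [← two_mul, ENNReal.add_div, ENNReal.add_halves]
    _ ≤ ε / 2 + (C * varCapacity p μ (A i) E + ε / 2) := add_le_add hδε hi.le
    _ = ε + C * varCapacity p μ (A i) E := by
        rw [add_left_comm, ENNReal.add_halves, add_comm]

/-- Continuity of the variational capacity along increasing sequences. -/
theorem varCapacity_iUnion_le {p : ℝ} (hp : 1 < p) {μ : Measure X} {E : Set X}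
    (hE : μ E < ⊤) {A : ℕ → Set X} (hA : Monotone A) :
    varCapacity p μ (⋃ n, A n) E ≤ ⨆ n, varCapacity p μ (A n) E := by
  have hp0 : 0 < p := by linarith
  obtain ⟨t, ht⟩ : ∃ t, ⨆ n, varCapacity p μ (A n) E = t := ⟨_, rfl⟩
  rw [ht]
  rcases eq_or_ne t ⊤ with rfl | htop
  · exact le_top
  have hex : ∀ n : ℕ, varCapacity p μ (A n) E < t + ((n : ℝ≥0∞) + 1)⁻¹ := fun n =>
    (ht ▸ le_iSup (fun n => varCapacity p μ (A n) E) n : _ ≤ t).trans_lt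
      (ENNReal.lt_add_right htop (by simp))
  choose f g hfg hf hg using fun n => exists_competitor_of_varCapacity_lt (hex n)
  obtain ⟨δ, hδ, hδsum⟩ := ENNReal.exists_pos_sum_of_countable (one_ne_zero) ℕ
  obtain ⟨φ, hφ, hφd⟩ := extraction_forall_of_eventually fun n =>
    eventually_lintegral_tsub_rpow_le hp hE hA ht htop hfg hf (fun n => (hg n).le)
      (ε := (δ n : ℝ≥0∞) ^ p) (by simp [(hδ n).ne'])
  have bound : ∀ m : ℕ, varCapacity p μ (⋃ n, A n) E ^ (1 / p) ≤
      (t + ((m : ℝ≥0∞) + 1)⁻¹) ^ (1 / p) + ∑' n, (δ (n + m) : ℝ≥0∞) := by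
    intro m
    have hcap := (IsCompetitor.iSup hp0 fun n => hfg (φ (n + m))).varCapacity_le
      (A := ⋃ n, A n) hp0 hE fun x hx => by
        obtain ⟨k, hk⟩ := mem_iUnion.1 hx
        exact IsCompetitor.iSup_eq_one (fun n => hfg (φ (n + m))) (n := k)
          (hf _ x (hA ((Nat.le_add_right k m).trans (hφ.id_le _)) hk))
    have hdm : ∀ n, Measurable fun x => g (φ (n + 1 + m)) x - g (φ (n + m)) x := fun n =>
      (hfg _).weakUG.1.sub (hfg _).weakUG.1
    calc varCapacity p μ (⋃ n, A n) E ^ (1 / p)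
        ≤ (∫⁻ x, (g (φ (0 + m)) x +
            ∑' n, (g (φ (n + 1 + m)) x - g (φ (n + m)) x)) ^ p ∂μ) ^ (1 / p) := by
          gcongr
          refine hcap.trans (lintegral_mono fun x => ?_)
          gcongr
          exact iSup_le_add_tsum_tsub fun n => g (φ (n + m)) x
      _ ≤ (∫⁻ x, g (φ (0 + m)) x ^ p ∂μ) ^ (1 / p) +
            (∫⁻ x, (∑' n, (g (φ (n + 1 + m)) x - g (φ (n + m)) x)) ^ p ∂μ) ^ (1 / p) :=
          ENNReal.lintegral_Lp_add_le (hfg _).weakUG.1.aemeasurable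
            (Measurable.tsum hdm).aemeasurable hp.le
      _ ≤ (t + ((m : ℝ≥0∞) + 1)⁻¹) ^ (1 / p) + ∑' n, (δ (n + m) : ℝ≥0∞) := by
          gcongr
          · rw [zero_add]
            refine (hg (φ m)).le.trans ?_
            gcongr
            exact hφ.id_le m
          · refine (lintegral_tsum_rpow_rpow_le hp.le hdm).trans (ENNReal.tsum_le_tsum fun n => ?_)
            have := hφd (n + m) (φ (n + 1 + m)) (hφ.monotone (by omega))
            calc _ ≤ ((δ (n + m) : ℝ≥0∞) ^ p) ^ (1 / p) := by gcongr
              _ = δ (n + m) := by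
                rw [← ENNReal.rpow_mul, mul_one_div_cancel hp0.ne', ENNReal.rpow_one]
  have lim : Tendsto (fun m : ℕ => (t + ((m : ℝ≥0∞) + 1)⁻¹) ^ (1 / p) +
      ∑' n, (δ (n + m) : ℝ≥0∞)) atTop (𝓝 (t ^ (1 / p) + 0)) := by
    refine Tendsto.add ?_ (ENNReal.tendsto_sum_nat_add (fun n => (δ n : ℝ≥0∞)) hδsum.ne_top)
    have h0 : Tendsto (fun n : ℕ => ((n : ℝ≥0∞) + 1)⁻¹) atTop (𝓝 0) := by
      have := (tendsto_add_atTop_iff_nat 1).2 ENNReal.tendsto_inv_nat_nhds_zero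
      simpa using this
    have h1 := tendsto_const_nhds (x := t) |>.add h0
    rw [add_zero] at h1
    exact (ENNReal.continuous_rpow_const.tendsto t).comp h1
  rw [add_zero] at lim
  exact (ENNReal.rpow_le_rpow_iff (by positivity)).1 (ge_of_tendsto' lim bound)


theorem secondCountableTopology_of_measure_ball {μ : Measure X}
    (hball : ∀ (x : X) (r : ℝ), 0 < r → 0 < μ (ball x r) ∧ μ (ball x r) < ⊤) :
    SecondCountableTopology X := by
  rcases isEmpty_or_nonempty X with hX | ⟨⟨x₀⟩⟩
  · infer_instance
  refine Metric.secondCountable_of_almost_dense_set fun ε hε => ?_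
  obtain ⟨N, hN⟩ := zorn_subset {N : Set X | N.Pairwise fun x y => ε < dist x y} <| by
    intro c hc hchain
    exact ⟨⋃₀ c, (pairwise_sUnion hchain.directedOn).2 fun s hs => hc hs,
      fun s hs => subset_sUnion_of_mem hs⟩
  refine ⟨N, ?_, fun x => ?_⟩
  · have hU : N = ⋃ n : ℕ, N ∩ ball x₀ n := by
      refine Subset.antisymm (fun x hx => ?_) (iUnion_subset fun n => inter_subset_left)
      obtain ⟨n, hn⟩ := exists_nat_gt (dist x x₀)
      exact mem_iUnion.2 ⟨n, hx, hn⟩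
    rw [hU]
    refine countable_iUnion fun n => ?_
    have hc := Measure.countable_meas_pos_of_disjoint_of_meas_iUnion_ne_top μ
      (As := fun y : ↥(N ∩ ball x₀ n) => ball (y : X) (ε / 2))
      (fun y => measurableSet_ball) (fun y z hyz => ?_) ?_
    · have : {y : ↥(N ∩ ball x₀ n) | 0 < μ (ball (y : X) (ε / 2))} = univ :=
        eq_univ_of_forall fun y => (hball y _ (half_pos hε)).1
      rw [this, countable_univ_iff] at hc
      exact hc.to_set
    · refine ball_disjoint_ball ?_
      rw [add_halves]
      exact (hN.prop y.2.1 z.2.1 (Subtype.coe_injective.ne hyz)).le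
    · refine ((measure_mono (iUnion_subset fun y => ?_)).trans_lt
        (hball x₀ (n + ε) (by positivity)).2).ne
      refine ball_subset_ball' ?_
      have := mem_ball.1 y.2.2
      linarith
  · by_contra! h
    have hx : insert x N ⊆ N := by
      refine hN.le_of_ge (y := insert x N) ?_ (subset_insert x N)
      exact pairwise_insert.2 ⟨hN.prop, fun y hy _ => ⟨h y hy, dist_comm x y ▸ h y hy⟩⟩
    have := h x (hx (mem_insert x N))
    rw [dist_self] at this
    exact this.not_ge hε.le

theorem analyticSet_of_measurableSet_of_sigmaCompact [SigmaCompactSpace X] {A : Set X}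
    (hA : MeasurableSet A) : AnalyticSet A := by
  have h : A = ⋃ n, ((↑) : compactCovering X n → X) '' ((↑) ⁻¹' A) := by
    simp_rw [Subtype.image_preimage_coe, ← iUnion_inter, iUnion_compactCovering, univ_inter]
  rw [h]
  refine AnalyticSet.iUnion fun n => ?_
  have : CompactSpace (compactCovering X n) :=
    isCompact_iff_compactSpace.1 (isCompact_compactCovering X n)
  have : PolishSpace (compactCovering X n) := inferInstance
  exact (hA.preimage measurable_subtype_coe).analyticSet.image_of_continuous
    continuous_subtype_val

/-- A compact box in Baire space. -/
theorem isCompact_setOf_forall_le (n : ℕ → ℕ) : IsCompact {x : ℕ → ℕ | ∀ i, x i ≤ n i} := by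
  have : {x : ℕ → ℕ | ∀ i, x i ≤ n i} = pi univ fun i => Iic (n i) := by
    ext x
    simp [Pi.le_def]
  rw [this]
  exact isCompact_univ_pi fun i => (finite_Iic (n i)).isCompact

/-- An open set containing the image of the box `∏ i, [0, n i]` contains the image of a box
in which only finitely many coordinates are restricted. -/
theorem exists_image_box_subset {Y : Type*} [TopologicalSpace Y] {f : (ℕ → ℕ) → Y}
    (hf : Continuous f) (n : ℕ → ℕ) {G : Set Y} (hG : IsOpen G)
    (h : f '' {x | ∀ i, x i ≤ n i} ⊆ G) : ∃ m, f '' {x | ∀ i < m, x i ≤ n i} ⊆ G := by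
  by_contra! hcon
  have hx : ∀ m, ∃ x : ℕ → ℕ, (∀ i < m, x i ≤ n i) ∧ f x ∉ G := by
    intro m
    obtain ⟨_, ⟨x, hx, rfl⟩, hxG⟩ := not_subset.1 (hcon m)
    exact ⟨x, hx, hxG⟩
  choose x hxn hxG using hx
  obtain ⟨y, hy, φ, hφ, hlim⟩ := (isCompact_setOf_forall_le n).tendsto_subseq
    (x := fun m i => min (x m i) (n i)) fun m i => min_le_right _ _
  have hlim' : Tendsto (x ∘ φ) atTop (𝓝 y) := by
    rw [tendsto_pi_nhds] at hlim ⊢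
    intro i
    refine (hlim i).congr' ?_
    filter_upwards [eventually_gt_atTop i] with m hm
    exact min_eq_left (hxn (φ m) i (hm.trans_le (hφ.id_le m)))
  have hmem : f y ∉ G :=
    hG.isClosed_compl.mem_of_tendsto ((hf.tendsto y).comp hlim')
      (Eventually.of_forall fun m => hxG (φ m))
  exact hmem (h ⟨y, hy, rfl⟩)

/-- Abstract form of Choquet's capacitability theorem: an analytic set is inner regular for
a monotone set function that is continuous along increasing sequences. -/
theorem exists_isCompact_lt_of_analyticSet {Y : Type*} [TopologicalSpace Y]
    {c : Set Y → ℝ≥0∞} (hmono : ∀ {S T : Set Y}, S ⊆ T → c S ≤ c T)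
    (hsup : ∀ S : ℕ → Set Y, Monotone S → c (⋃ n, S n) ≤ ⨆ n, c (S n))
    {A : Set Y} (hA : AnalyticSet A) (hne : A.Nonempty) {t : ℝ≥0∞} (ht : t < c A) :
    ∃ K, IsCompact K ∧ K ⊆ A ∧ ∀ G, IsOpen G → K ⊆ G → t < c G := by
  rw [AnalyticSet] at hA
  obtain ⟨f, hf, rfl⟩ := hA.resolve_left hne.ne_empty
  let S : ℕ → (ℕ → ℕ) → Set Y := fun m n => f '' {x | ∀ i < m, x i ≤ n i}
  have hstep : ∀ m n, t < c (S m n) → ∃ k, t < c (S (m + 1) (Function.update n m k)) := by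
    intro m n hmn
    have hU : S m n ⊆ ⋃ k, S (m + 1) (Function.update n m k) := by
      rintro _ ⟨x, hx, rfl⟩
      refine mem_iUnion.2 ⟨x m, x, fun i hi => ?_, rfl⟩
      rcases (Nat.lt_succ_iff.1 hi).eq_or_lt with rfl | hi
      · simp
      · simpa [hi.ne] using hx i hi
    have hM : Monotone fun k => S (m + 1) (Function.update n m k) := by
      intro k l hkl
      refine image_mono fun x hx i hi => (hx i hi).trans ?_
      exact update_le_update_iff.2 ⟨hkl, fun _ _ => le_rfl⟩ i
    exact lt_iSup_iff.1 ((hmn.trans_le (hmono hU)).trans_le (hsup _ hM))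
  have h0 : t < c (S 0 0) := by simpa [S] using ht
  choose! k hk using hstep
  let N : ℕ → ℕ → ℕ := fun m => Nat.rec 0 (fun m n => Function.update n m (k m n)) m
  have hN : ∀ m, t < c (S m (N m)) := by
    intro m
    induction m with
    | zero => exact h0
    | succ m ih => exact hk m _ ih
  let n : ℕ → ℕ := fun i => N (i + 1) i
  have hNn : ∀ m, ∀ i < m, N m i = n i := by
    intro m i hi
    induction m, hi using Nat.le_induction with
    | base => rfl
    | succ m hm ih =>
      have : N (m + 1) i = N m i := Function.update_of_ne (Nat.lt_of_succ_le hm).ne _ _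
      rw [this, ih]
  refine ⟨f '' {x | ∀ i, x i ≤ n i}, (isCompact_setOf_forall_le n).image hf,
    image_subset_range _ _, fun G hG hKG => ?_⟩
  obtain ⟨m, hm⟩ := exists_image_box_subset hf n hG hKG
  have hS : S m (N m) = f '' {x | ∀ i < m, x i ≤ n i} := by
    simp only [S]
    congr 1
    ext x
    exact forall₂_congr fun i hi => by rw [hNn m i hi]
  exact (hN m).trans_le (hmono (hS ▸ hm))

/-- Choquet's capacitability theorem for `cap_p`: Borel subsets of
`int E` are capacitable. -/
theorem stmt_15 [LocallyCompactSpace X] (p : ℝ) (hp : 1 < p) (μ : Measure X)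
    (hball : ∀ (x : X) (r : ℝ), 0 < r → 0 < μ (Metric.ball x r) ∧ μ (Metric.ball x r) < ⊤)
    (hqc : ∀ u : X → EReal, MemNewtonian p μ u → QuasicontinuousFun p μ u)
    (E : Set X) (hE : Bornology.IsBounded E)
    (A : Set X) (hA : A ⊆ interior E) (hBorel : MeasurableSet A) :
    varCapacity p μ A E =
        (⨆ (K : Set X) (_ : IsCompact K ∧ K ⊆ A), varCapacity p μ K E) ∧
      varCapacity p μ A E =
        ⨅ (G : Set X) (_ : IsOpen G ∧ A ⊆ G ∧ G ⊆ E), varCapacity p μ G E := by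
  have := secondCountableTopology_of_measure_ball hball
  have hEμ : μ E < ⊤ := measure_lt_top_of_isBounded hball hE
  have houter : ∀ {S : Set X} {c : ℝ≥0∞}, S ⊆ interior E → varCapacity p μ S E < c →
      ∃ G, IsOpen G ∧ S ⊆ G ∧ G ⊆ E ∧ varCapacity p μ G E < c :=
    fun hS hc => exists_isOpen_varCapacity_lt hp hqc hEμ hS hc
  refine ⟨le_antisymm (le_of_forall_lt fun t ht => ?_)
    (iSup₂_le fun K hK => varCapacity_mono hK.2),
    le_antisymm (le_iInf₂ fun G hG => varCapacity_mono hG.2.1)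
      (le_of_forall_gt fun c hc => ?_)⟩
  · rcases A.eq_empty_or_nonempty with rfl | hne
    · exact ht.trans_le (le_iSup₂_of_le ∅ ⟨isCompact_empty, Subset.rfl⟩ le_rfl)
    obtain ⟨s, hts, hs⟩ := exists_between ht
    obtain ⟨K, hK, hKA, hKG⟩ := exists_isCompact_lt_of_analyticSet
      (c := fun S => varCapacity p μ S E) (fun h => varCapacity_mono h)
      (fun S hS => varCapacity_iUnion_le hp hEμ hS)
      (analyticSet_of_measurableSet_of_sigmaCompact hBorel) hne hs
    refine hts.trans_le (le_trans ?_
      (le_iSup₂ (f := fun (K : Set X) (_ : IsCompact K ∧ K ⊆ A) => varCapacity p μ K E)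
        K ⟨hK, hKA⟩))
    by_contra! hlt
    obtain ⟨G, hG, hSG, -, hGs⟩ := houter (hKA.trans hA) hlt
    exact (hKG G hG hSG).not_gt hGs
  · obtain ⟨G, hG, hAG, hGE, hGc⟩ := houter hA hc
    exact (iInf₂_le G ⟨hG, hAG, hGE⟩).trans_lt hGc

end
end

section
/- Let ℝ^n be equipped with a p-admissible weight w, p > 1, and let Ω ⊂ ℝ^n be a nonempty bounded open set. Then the Newtonian variational capacity cap_p(A, Ω) (with X = ℝ^n equipped with dμ = w dx) coincides with the variational capacity cap_{p,μ}(A, Ω) of Heinonen–Kilpeläinen–Martio for every A ⊂ Ω. -/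
open MeasureTheory Metric Set Filter
open scoped ENNReal NNReal Topology

noncomputable section

variable {X : Type*} [MetricSpace X] [MeasurableSpace X] [BorelSpace X]

variable {n : ℕ}

/-- The measure `μ` is doubling: `0 < μ(2B) ≤ C μ(B) < ∞` for all balls `B`. -/
def IsDoublingMeasure {Y : Type*} [MetricSpace Y] [MeasurableSpace Y]
    (μ : Measure Y) : Prop :=
  ∃ C : ℝ≥0, ∀ (x : Y) (r : ℝ), 0 < r →
    0 < μ (Metric.ball x r) ∧
    μ (Metric.ball x (2 * r)) ≤ (C : ℝ≥0∞) * μ (Metric.ball x r) ∧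
    μ (Metric.ball x r) < ⊤

/-- `Y` (with measure `μ`) supports a `(1,p)`-Poincaré inequality: there are `C > 0`
and a dilation `λ ≥ 1` such that `⨍_B |u − u_B| dμ ≤ C diam B (⨍_{λB} g^p dμ)^{1/p}`
for all balls `B`, all integrable `u ∈ N^{1,p}` and all `p`-weak upper gradients `g`
of `u` (this is equivalent to the formulation with the minimal `p`-weak upper
gradient `g_u`). -/
def SupportsPoincare {Y : Type*} [MetricSpace Y] [MeasurableSpace Y] [BorelSpace Y]
    (p : ℝ) (μ : Measure Y) : Prop :=
  ∃ (C lam : ℝ), 0 < C ∧ 1 ≤ lam ∧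
    ∀ (x : Y) (r : ℝ), 0 < r → ∀ (u : Y → ℝ) (g : Y → ℝ≥0∞),
      MemNewtonian p μ (fun y => (u y : EReal)) → Integrable u μ →
      IsWeakUpperGradient p μ (fun y => (u y : EReal)) g →
      (μ (Metric.ball x r))⁻¹ *
          ∫⁻ y in Metric.ball x r,
            ENNReal.ofReal |u y - ⨍ z in Metric.ball x r, u z ∂μ| ∂μ
        ≤ ENNReal.ofReal C * EMetric.diam (Metric.ball x r) *
          ((μ (Metric.ball x (lam * r)))⁻¹ *
            ∫⁻ y in Metric.ball x (lam * r), g y ^ p ∂μ) ^ (1 / p)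

/-- `w` is a `p`-admissible weight on `ℝⁿ`: the measure `dμ = w dx` is doubling and
supports a `(1,p)`-Poincaré inequality. -/
def IsPAdmissibleWeight (p : ℝ) (w : EuclideanSpace ℝ (Fin n) → ℝ≥0∞) : Prop :=
  Measurable w ∧ IsDoublingMeasure (volume.withDensity w) ∧
    SupportsPoincare p (volume.withDensity w)

/-- The Heinonen–Kilpeläinen–Martio variational capacity of a compact set `K ⊆ Ω`,
defined via smooth compactly supported test functions. -/
def capHKMCompact (p : ℝ) (μ : Measure (EuclideanSpace ℝ (Fin n)))
    (K Ω : Set (EuclideanSpace ℝ (Fin n))) : ℝ≥0∞ :=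
  ⨅ (u : EuclideanSpace ℝ (Fin n) → ℝ)
    (_ : ContDiff ℝ (⊤ : ℕ∞) u ∧ HasCompactSupport u ∧ tsupport u ⊆ Ω ∧ ∀ x ∈ K, 1 ≤ u x),
    ∫⁻ x in Ω, (‖fderiv ℝ u x‖₊ : ℝ≥0∞) ^ p ∂μ

/-- The HKM capacity of an open set `G ⊆ Ω`, by inner regularity. -/
def capHKMOpen (p : ℝ) (μ : Measure (EuclideanSpace ℝ (Fin n)))
    (G Ω : Set (EuclideanSpace ℝ (Fin n))) : ℝ≥0∞ :=
  ⨆ (K : Set (EuclideanSpace ℝ (Fin n))) (_ : IsCompact K ∧ K ⊆ G),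
    capHKMCompact p μ K Ω

/-- The HKM capacity of an arbitrary set `A ⊆ Ω`, by outer regularity. -/
def capHKM (p : ℝ) (μ : Measure (EuclideanSpace ℝ (Fin n)))
    (A Ω : Set (EuclideanSpace ℝ (Fin n))) : ℝ≥0∞ :=
  ⨅ (G : Set (EuclideanSpace ℝ (Fin n))) (_ : IsOpen G ∧ A ⊆ G ∧ G ⊆ Ω),
    capHKMOpen p μ G Ω

/-! ### Curves -/

section CurveLemmas

variable {E : Type*} [MetricSpace E]

lemma Curve.lipschitzOnWith (γ : Curve E) : LipschitzOnWith 1 γ.toFun (Icc 0 γ.len) := by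
  have key : ∀ s ∈ Icc 0 γ.len, ∀ t ∈ Icc 0 γ.len, s ≤ t →
      edist (γ.toFun s) (γ.toFun t) ≤ edist s t := by
    intro s hs t ht hst
    calc edist (γ.toFun s) (γ.toFun t) ≤ eVariationOn γ.toFun (Icc s t) :=
          eVariationOn.edist_le _ ⟨le_rfl, hst⟩ ⟨hst, le_rfl⟩
      _ = edist s t := by
          rw [γ.arclength s t hs ht hst, edist_comm, edist_dist, Real.dist_eq,
            abs_of_nonneg (sub_nonneg.2 hst)]
  intro s hs t ht
  rw [ENNReal.coe_one, one_mul]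
  rcases le_total s t with h | h
  · exact key s hs t ht h
  · rw [edist_comm, edist_comm s]
    exact key t ht s hs h

/-- The curve `γ`, extended to a globally defined `1`-Lipschitz map. -/
def Curve.extend (γ : Curve E) : ℝ → E := fun t => γ.toFun (projIcc 0 γ.len γ.len_pos.le t)

lemma Curve.extend_of_mem (γ : Curve E) {t : ℝ} (ht : t ∈ Icc 0 γ.len) :
    γ.extend t = γ.toFun t := by
  simp [Curve.extend, projIcc_of_mem γ.len_pos.le ht]

lemma Curve.lipschitzWith_extend (γ : Curve E) : LipschitzWith 1 γ.extend := by
  have := γ.lipschitzOnWith.to_restrict.comp (LipschitzWith.projIcc γ.len_pos.le)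
  rwa [one_mul] at this

/-- A `1`-Lipschitz path can be reparameterized by arc length without increasing integrals. -/
lemma exists_curve_integral_le [MeasurableSpace E] [BorelSpace E] {γ : ℝ → E}
    (hγ : LipschitzWith 1 γ) {T : ℝ} (hT : 0 ≤ T) (hne : γ 0 ≠ γ T) :
    ∃ c : Curve E, c.toFun 0 = γ 0 ∧ c.toFun c.len = γ T ∧
      ∀ g : E → ℝ≥0∞, Measurable g → c.integral g ≤ ∫⁻ t in Icc 0 T, g (γ t) := by
  set s := Icc (0 : ℝ) T with hs
  have h0 : (0 : ℝ) ∈ s := ⟨le_rfl, hT⟩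
  have hTs : T ∈ s := ⟨hT, le_rfl⟩
  have hbv : LocallyBoundedVariationOn γ s := hγ.locallyBoundedVariationOn s
  set v : ℝ → ℝ := variationOnFromTo γ s 0 with hv
  set N := naturalParameterization γ s 0 with hN
  have hNv : ∀ t ∈ s, N (v t) = γ t := fun t ht =>
    edist_eq_zero.1 (edist_naturalParameterization_eq_zero hbv h0 ht)
  have hv0 : v 0 = 0 := variationOnFromTo.self _ _ _
  have hmono : MonotoneOn v s := variationOnFromTo.monotoneOn hbv h0
  have hstep : ∀ a ∈ s, ∀ b ∈ s, a ≤ b → v b - v a ≤ b - a := by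
    intro a ha b hb hab
    have h1 : v a + variationOnFromTo γ s a b = v b := variationOnFromTo.add hbv h0 ha hb
    have h2 : variationOnFromTo γ s a b ≤ b - a := by
      rw [variationOnFromTo.eq_of_le _ _ hab]
      refine ENNReal.toReal_le_of_le_ofReal (sub_nonneg.2 hab) ?_
      have h3 := (hγ.lipschitzOnWith (s := univ)).comp_eVariationOn_le
        (g := id) (s := s ∩ Icc a b) (mapsTo_univ _ _)
      rw [ENNReal.coe_one, one_mul] at h3
      exact h3.trans ((monotone_id.monotoneOn s).eVariationOn_eq ha hb).le
    linarith
  have hlip : LipschitzOnWith 1 v s := by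
    refine LipschitzOnWith.of_dist_le_mul fun a ha b hb => ?_
    rw [NNReal.coe_one, one_mul, Real.dist_eq, Real.dist_eq]
    rcases le_total a b with h | h
    · rw [abs_sub_comm, abs_sub_comm a, abs_of_nonneg (sub_nonneg.2 (hmono ha hb h)),
        abs_of_nonneg (sub_nonneg.2 h)]
      exact hstep a ha b hb h
    · rw [abs_of_nonneg (sub_nonneg.2 (hmono hb ha h)), abs_of_nonneg (sub_nonneg.2 h)]
      exact hstep b hb a ha h
  have himg : v '' s = Icc 0 (v T) := by
    apply Subset.antisymm
    · rintro _ ⟨t, ht, rfl⟩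
      exact ⟨hv0 ▸ hmono h0 ht ht.1, hmono ht hTs ht.2⟩
    · have := intermediate_value_Icc hT hlip.continuousOn
      rwa [hv0] at this
  have hspeed : HasUnitSpeedOn N (Icc 0 (v T)) := by
    have := has_unit_speed_naturalParameterization γ hbv h0
    rwa [← hv, himg] at this
  have hvT : 0 ≤ v T := hv0 ▸ hmono h0 hTs hT
  have hvTpos : 0 < v T := by
    refine lt_of_le_of_ne hvT fun h => hne ?_
    rw [← hNv 0 h0, ← hNv T hTs, hv0, ← h]
  have harc : ∀ a b : ℝ, a ∈ Icc 0 (v T) → b ∈ Icc 0 (v T) → a ≤ b →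
      eVariationOn N (Icc a b) = ENNReal.ofReal (b - a) := by
    intro a b ha hb hab
    have := hspeed ha hb
    rw [NNReal.coe_one, one_mul] at this
    rwa [inter_eq_self_of_subset_right (Icc_subset_Icc ha.1 hb.2)] at this
  have hcont : ContinuousOn N (Icc 0 (v T)) := by
    have key : ∀ a ∈ Icc 0 (v T), ∀ b ∈ Icc 0 (v T), a ≤ b → edist (N a) (N b) ≤ edist a b := by
      intro a ha b hb hab
      refine (eVariationOn.edist_le N (s := Icc a b) ⟨le_rfl, hab⟩ ⟨hab, le_rfl⟩).trans_eq ?_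
      rw [harc a b ha hb hab, edist_comm, edist_dist, Real.dist_eq,
        abs_of_nonneg (sub_nonneg.2 hab)]
    have : LipschitzOnWith 1 N (Icc 0 (v T)) := by
      intro a ha b hb
      rw [ENNReal.coe_one, one_mul]
      rcases le_total a b with h | h
      · exact key a ha b hb h
      · rw [edist_comm, edist_comm a]
        exact key b hb a ha h
    exact this.continuousOn
  refine ⟨⟨v T, hvTpos, N, hcont, harc, 0, ⟨le_rfl, hvT⟩, v T, ⟨hvT, le_rfl⟩, ?_⟩, ?_, hNv T hTs,
    ?_⟩
  · rw [hNv T hTs, ← hv0, hNv 0 h0]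
    exact hne
  · change N 0 = γ 0
    rw [← hNv 0 h0, hv0]
  intro g hg
  change ∫⁻ t in Icc 0 (v T), g (N t) ≤ _
  have hvmeas : AEMeasurable v (volume.restrict s) :=
    hlip.continuousOn.aemeasurable measurableSet_Icc
  have hle : volume.restrict (Icc 0 (v T)) ≤ (volume.restrict s).map v := by
    refine Measure.le_iff.2 fun S hS => ?_
    rw [Measure.map_apply_of_aemeasurable hvmeas hS, Measure.restrict_apply hS,
      Measure.restrict_apply' measurableSet_Icc, inter_comm S, ← himg]
    have h1 : v '' s ∩ S = v '' (v ⁻¹' S ∩ s) := by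
      ext y
      constructor
      · rintro ⟨⟨t, ht, rfl⟩, hS'⟩
        exact ⟨t, ⟨hS', ht⟩, rfl⟩
      · rintro ⟨t, ⟨hS', ht⟩, rfl⟩
        exact ⟨⟨t, ht, rfl⟩, hS'⟩
    rw [h1, ← hausdorffMeasure_real]
    have h2 := (hlip.mono (inter_subset_right (s := v ⁻¹' S))).hausdorffMeasure_image_le
      (d := 1) zero_le_one
    simpa using h2
  have hNmeas : Measurable fun t => N (projIcc 0 (v T) hvT t) :=
    (hcont.comp_continuous (continuous_subtype_val.comp continuous_projIcc)
      fun t => (projIcc 0 (v T) hvT t).2).measurable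
  calc ∫⁻ t in Icc 0 (v T), g (N t)
      = ∫⁻ t in Icc 0 (v T), g (N (projIcc 0 (v T) hvT t)) := by
        refine setLIntegral_congr_fun measurableSet_Icc fun t ht => ?_
        simp only [projIcc_of_mem hvT ht]
    _ ≤ ∫⁻ t, g (N (projIcc 0 (v T) hvT t)) ∂((volume.restrict s).map v) :=
        lintegral_mono' hle le_rfl
    _ = ∫⁻ t in s, g (N (projIcc 0 (v T) hvT (v t))) :=
        lintegral_map' (hg.comp hNmeas).aemeasurable hvmeas
    _ = ∫⁻ t in s, g (γ t) := by
        refine setLIntegral_congr_fun measurableSet_Icc fun t ht => ?_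
        have hvt : v t ∈ Icc 0 (v T) := himg ▸ mem_image_of_mem v ht
        simp only [projIcc_of_mem hvT hvt, hNv t ht]

end CurveLemmas

/-- Along a `1`-Lipschitz path, a `C¹` function varies at most by the integral of the norm of
its derivative. -/
lemma abs_sub_le_lintegral_fderiv {E : Type*} [NormedAddCommGroup E] [NormedSpace ℝ E]
    {u : E → ℝ} (hu : ContDiff ℝ 1 u) {γ : ℝ → E} (hγ : LipschitzWith 1 γ) {T : ℝ}
    (hT : 0 ≤ T) :
    ENNReal.ofReal |u (γ T) - u (γ 0)| ≤ ∫⁻ t in Icc 0 T, (‖fderiv ℝ u (γ t)‖₊ : ℝ≥0∞) := by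
  have hγc : Continuous γ := hγ.continuous
  have hφ : Continuous fun t => ‖fderiv ℝ u (γ t)‖ :=
    ((hu.continuous_fderiv one_ne_zero).comp hγc).norm
  have hB : ∀ x, HasDerivAt (fun t => ∫ s in (0 : ℝ)..t, ‖fderiv ℝ u (γ s)‖)
      ‖fderiv ℝ u (γ x)‖ x := fun x =>
    intervalIntegral.integral_hasDerivAt_right (hφ.intervalIntegrable _ _)
      (hφ.stronglyMeasurableAtFilter _ _) hφ.continuousAt
  have key : ∀ σ : ℝ, |σ| = 1 →
      σ * (u (γ T) - u (γ 0)) ≤ ∫ s in (0 : ℝ)..T, ‖fderiv ℝ u (γ s)‖ := by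
    intro σ hσ
    have hmem : T ∈ Icc (0 : ℝ) T := ⟨hT, le_rfl⟩
    refine image_le_of_liminf_slope_right_le_deriv_boundary
      (f := fun t => σ * (u (γ t) - u (γ 0)))
      (B := fun t => ∫ s in (0 : ℝ)..t, ‖fderiv ℝ u (γ s)‖) ?_ ?_
      (fun x _ => (hB x).continuousAt.continuousWithinAt)
      (fun x _ => (hB x).hasDerivWithinAt) ?_ hmem
    · exact ((hu.continuous.comp hγc).sub continuous_const).continuousOn.const_smul σ
    · simp
    · intro x _ r hr
      apply Eventually.frequently
      obtain ⟨K, hK1, hK2⟩ := exists_between hr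
      lift K to ℝ≥0 using (norm_nonneg _).trans hK1.le
      obtain ⟨S, hS, hlip⟩ := (hu.contDiffAt.hasStrictFDerivAt
        (x := γ x) one_ne_zero).exists_lipschitzOnWith_of_nnnorm_lt K (by exact_mod_cast hK1)
      have h1 : ∀ᶠ z in 𝓝[>] x, γ z ∈ S :=
        (hγc.continuousAt.mono_left nhdsWithin_le_nhds) hS
      filter_upwards [h1, self_mem_nhdsWithin] with z hz hxz
      have hxz' : 0 < z - x := sub_pos.2 hxz
      refine lt_of_le_of_lt ?_ hK2
      rw [slope_def_field, div_le_iff₀ hxz']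
      have h2 := hlip.dist_le_mul _ hz _ (mem_of_mem_nhds hS)
      have h3 := hγ.dist_le_mul z x
      rw [NNReal.coe_one, one_mul, Real.dist_eq, abs_of_pos hxz'] at h3
      rw [Real.dist_eq] at h2
      calc σ * (u (γ z) - u (γ 0)) - σ * (u (γ x) - u (γ 0))
          = σ * (u (γ z) - u (γ x)) := by ring
        _ ≤ |σ * (u (γ z) - u (γ x))| := le_abs_self _
        _ = |u (γ z) - u (γ x)| := by rw [abs_mul, hσ, one_mul]
        _ ≤ K * dist (γ z) (γ x) := h2
        _ ≤ K * (z - x) := by gcongr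
  have habs : |u (γ T) - u (γ 0)| ≤ ∫ s in (0 : ℝ)..T, ‖fderiv ℝ u (γ s)‖ := by
    refine abs_le'.2 ⟨?_, ?_⟩
    · simpa using key 1 (by simp)
    · simpa using key (-1) (by simp)
  refine (ENNReal.ofReal_le_ofReal habs).trans ?_
  rw [intervalIntegral.integral_of_le hT, ← integral_Icc_eq_integral_Ioc,
    ofReal_integral_eq_lintegral_ofReal hφ.continuousOn.integrableOn_Icc
      (ae_of_all _ fun _ => norm_nonneg _)]
  refine lintegral_mono fun t => ?_
  rw [ofReal_norm]
  exact le_rfl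

/-! ### Uniform convexity and the upper bound -/

/-- A quantitative form of the strict convexity of `x ↦ x ^ p`. -/
lemma exists_rpow_sub_add_mul_le {p : ℝ} (hp : 1 < p) {θ : ℝ} (hθ : 0 < θ) :
    ∃ C : ℝ, 0 ≤ C ∧ ∀ a b : ℝ, 0 ≤ a → 0 ≤ b →
      max (b ^ p - a ^ p) 0 + C * ((a + b) / 2) ^ p ≤
        θ * (a ^ p + b ^ p) + C * ((a ^ p + b ^ p) / 2) := by
  have hp0 : 0 < p := by linarith
  have hconv := strictConvexOn_rpow hp
  have hD : ∀ a b : ℝ, 0 ≤ a → 0 ≤ b → ((a + b) / 2) ^ p ≤ (a ^ p + b ^ p) / 2 := by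
    intro a b ha hb
    have := hconv.convexOn.2 (mem_Ici.2 ha) (mem_Ici.2 hb) (by norm_num : (0 : ℝ) ≤ 1 / 2)
      (by norm_num : (0 : ℝ) ≤ 1 / 2) (by norm_num)
    simp only [smul_eq_mul] at this
    calc ((a + b) / 2) ^ p = (1 / 2 * a + 1 / 2 * b) ^ p := by congr 1; ring
      _ ≤ _ := this
      _ = _ := by ring
  have hDs : ∀ t : ℝ, 0 ≤ t → t ≠ 1 → ((t + 1) / 2) ^ p < (t ^ p + 1) / 2 := by
    intro t ht ht1
    have := hconv.2 (mem_Ici.2 ht) (mem_Ici.2 zero_le_one) ht1 (by norm_num : (0 : ℝ) < 1 / 2)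
      (by norm_num : (0 : ℝ) < 1 / 2) (by norm_num)
    simp only [smul_eq_mul, Real.one_rpow] at this
    calc ((t + 1) / 2) ^ p = (1 / 2 * t + 1 / 2 * 1) ^ p := by congr 1; ring
      _ < _ := this
      _ = _ := by ring
  have hcp : Continuous fun t : ℝ => t ^ p := Real.continuous_rpow_const hp0.le
  set S : Set ℝ := Icc 0 1 ∩ {t | θ * (t ^ p + 1) ≤ 1 - t ^ p} with hS
  have hSc : IsCompact S :=
    isCompact_Icc.inter_right (isClosed_le (by fun_prop) (by fun_prop))
  have hcD : Continuous fun t : ℝ => (t ^ p + 1) / 2 - ((t + 1) / 2) ^ p := by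
    have : Continuous fun t : ℝ => ((t + 1) / 2) ^ p := hcp.comp (by fun_prop)
    fun_prop
  have hm : ∃ m > 0, ∀ t ∈ S, m ≤ (t ^ p + 1) / 2 - ((t + 1) / 2) ^ p := by
    rcases S.eq_empty_or_nonempty with h | h
    · exact ⟨1, one_pos, by simp [h]⟩
    · obtain ⟨t₀, ht₀, hmin⟩ := hSc.exists_isMinOn h hcD.continuousOn
      refine ⟨_, sub_pos.2 (hDs t₀ ht₀.1.1 ?_), fun t ht => hmin ht⟩
      rintro rfl
      have := ht₀.2
      simp only [mem_ofPred_eq, Real.one_rpow] at this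
      linarith
  obtain ⟨m, hm0, hm⟩ := hm
  refine ⟨1 / m, by positivity, fun a b ha hb => ?_⟩
  have hap : 0 ≤ a ^ p := Real.rpow_nonneg ha p
  have hbp : 0 ≤ b ^ p := Real.rpow_nonneg hb p
  have hCD : 1 / m * ((a + b) / 2) ^ p ≤ 1 / m * ((a ^ p + b ^ p) / 2) :=
    mul_le_mul_of_nonneg_left (hD a b ha hb) (by positivity)
  have hθab : 0 ≤ θ * (a ^ p + b ^ p) := by positivity
  rcases le_or_gt (b ^ p - a ^ p) (θ * (a ^ p + b ^ p)) with h | h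
  · exact add_le_add (max_le h hθab) hCD
  · have hab : a ^ p < b ^ p := by linarith
    have hblt : a < b := (Real.rpow_lt_rpow_iff ha hb hp0).1 hab
    have hb0 : 0 < b := ha.trans_lt hblt
    have hbp0 : 0 < b ^ p := Real.rpow_pos_of_pos hb0 p
    set t := a / b with ht
    have htb : a = t * b := by rw [ht]; field_simp
    have ht0 : 0 ≤ t := by positivity
    have ht1 : t ≤ 1 := (div_le_one hb0).2 hblt.le
    have hap' : a ^ p = t ^ p * b ^ p := by rw [htb, Real.mul_rpow ht0 hb]
    have hmid : ((a + b) / 2) ^ p = ((t + 1) / 2) ^ p * b ^ p := by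
      rw [← Real.mul_rpow (by positivity) hb, htb]
      congr 1
      ring
    have htS : t ∈ S := by
      refine ⟨⟨ht0, ht1⟩, ?_⟩
      rw [hap'] at h
      have : θ * (t ^ p + 1) * b ^ p ≤ (1 - t ^ p) * b ^ p := by linarith
      exact le_of_mul_le_mul_right this hbp0
    have h1 := hm t htS
    have h2 : 1 ≤ 1 / m * ((t ^ p + 1) / 2 - ((t + 1) / 2) ^ p) := by
      rw [one_div, ← div_eq_inv_mul, one_le_div hm0]
      exact h1
    have h3 : b ^ p ≤ 1 / m * ((t ^ p + 1) / 2 - ((t + 1) / 2) ^ p) * b ^ p := by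
      nlinarith
    rw [max_eq_left (by linarith), hmid, hap']
    rw [hap'] at hap hθab
    nlinarith

lemma exists_rpow_tsub_add_mul_le {p : ℝ} (hp : 1 < p) {θ : ℝ≥0} (hθ : 0 < θ) :
    ∃ C : ℝ≥0, ∀ a b : ℝ≥0,
      ((b : ℝ≥0∞) ^ p - (a : ℝ≥0∞) ^ p) + C * (((a + b) / 2 : ℝ≥0) : ℝ≥0∞) ^ p ≤
        θ * ((a : ℝ≥0∞) ^ p + (b : ℝ≥0∞) ^ p) + C * (((a : ℝ≥0∞) ^ p + (b : ℝ≥0∞) ^ p) / 2) := by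
  obtain ⟨C, hC, h⟩ := exists_rpow_sub_add_mul_le hp (θ := θ) (by exact_mod_cast hθ)
  lift C to ℝ≥0 using hC
  refine ⟨C, fun a b => ?_⟩
  have hp0 : 0 ≤ p := by linarith
  have key : (b ^ p - a ^ p) + C * ((a + b) / 2) ^ p ≤
      θ * (a ^ p + b ^ p) + C * ((a ^ p + b ^ p) / 2) := by
    rw [← NNReal.coe_le_coe]
    push_cast [NNReal.coe_sub_def]
    exact h a b a.2 b.2
  have h2 : (((a : ℝ≥0∞) ^ p + (b : ℝ≥0∞) ^ p) / 2) = (((a ^ p + b ^ p) / 2 : ℝ≥0) : ℝ≥0∞) := by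
    rw [ENNReal.coe_div two_ne_zero, ENNReal.coe_add, ENNReal.coe_rpow_of_nonneg _ hp0,
      ENNReal.coe_rpow_of_nonneg _ hp0, ENNReal.coe_ofNat]
  rw [h2, ← ENNReal.coe_rpow_of_nonneg _ hp0, ← ENNReal.coe_rpow_of_nonneg _ hp0,
    ← ENNReal.coe_rpow_of_nonneg _ hp0]
  exact_mod_cast key

/-- Admissible test functions for the Heinonen–Kilpeläinen–Martio capacity of a compact set. -/
def IsTestFunction (K Ω : Set (EuclideanSpace ℝ (Fin n))) (u : EuclideanSpace ℝ (Fin n) → ℝ) :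
    Prop :=
  ContDiff ℝ (⊤ : ℕ∞) u ∧ HasCompactSupport u ∧ tsupport u ⊆ Ω ∧ ∀ x ∈ K, 1 ≤ u x

lemma IsTestFunction.mono {K K' Ω : Set (EuclideanSpace ℝ (Fin n))}
    {u : EuclideanSpace ℝ (Fin n) → ℝ} (hu : IsTestFunction K' Ω u) (h : K ⊆ K') :
    IsTestFunction K Ω u :=
  ⟨hu.1, hu.2.1, hu.2.2.1, fun x hx => hu.2.2.2 x (h hx)⟩

lemma IsTestFunction.contDiff_one {K Ω : Set (EuclideanSpace ℝ (Fin n))}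
    {u : EuclideanSpace ℝ (Fin n) → ℝ} (hu : IsTestFunction K Ω u) : ContDiff ℝ 1 u :=
  hu.1.of_le (by exact_mod_cast le_top)

lemma IsTestFunction.differentiable {K Ω : Set (EuclideanSpace ℝ (Fin n))}
    {u : EuclideanSpace ℝ (Fin n) → ℝ} (hu : IsTestFunction K Ω u) : Differentiable ℝ u :=
  hu.contDiff_one.differentiable one_ne_zero

lemma IsTestFunction.measurable_nnnorm_fderiv {K Ω : Set (EuclideanSpace ℝ (Fin n))}
    {u : EuclideanSpace ℝ (Fin n) → ℝ} (hu : IsTestFunction K Ω u) :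
    Measurable fun x => (‖fderiv ℝ u x‖₊ : ℝ≥0∞) :=
  (ENNReal.continuous_coe.comp
    (hu.contDiff_one.continuous_fderiv one_ne_zero).nnnorm).measurable

lemma IsTestFunction.midpoint {K Ω : Set (EuclideanSpace ℝ (Fin n))}
    {u v : EuclideanSpace ℝ (Fin n) → ℝ} (hu : IsTestFunction K Ω u) (hv : IsTestFunction K Ω v) :
    IsTestFunction K Ω fun x => (1 / 2 : ℝ) * (u x + v x) := by
  have hsub : tsupport (fun x => (1 / 2 : ℝ) * (u x + v x)) ⊆ tsupport u ∪ tsupport v := by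
    rw [tsupport, tsupport, tsupport, ← closure_union]
    refine closure_mono fun x hx => ?_
    by_contra hcon
    simp only [mem_union, Function.mem_support, not_or, not_not] at hcon
    exact hx (by simp [hcon.1, hcon.2])
  refine ⟨contDiff_const.mul (hu.1.add hv.1), ?_, ?_, ?_⟩
  · exact (hu.2.1.isCompact.union hv.2.1.isCompact).of_isClosed_subset (isClosed_tsupport _) hsub
  · exact hsub.trans (union_subset hu.2.2.1 hv.2.2.1)
  · intro x hx
    have h1 := hu.2.2.2 x hx
    have h2 := hv.2.2.2 x hx
    linarith

lemma capHKMCompact_le {p : ℝ} {μ : Measure (EuclideanSpace ℝ (Fin n))}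
    {K Ω : Set (EuclideanSpace ℝ (Fin n))} {u : EuclideanSpace ℝ (Fin n) → ℝ}
    (hu : IsTestFunction K Ω u) :
    capHKMCompact p μ K Ω ≤ ∫⁻ x in Ω, (‖fderiv ℝ u x‖₊ : ℝ≥0∞) ^ p ∂μ :=
  iInf₂_le u hu

lemma exists_isTestFunction_of_capHKMCompact_lt {p : ℝ}
    {μ : Measure (EuclideanSpace ℝ (Fin n))} {K Ω : Set (EuclideanSpace ℝ (Fin n))} {c : ℝ≥0∞}
    (h : capHKMCompact p μ K Ω < c) :
    ∃ u, IsTestFunction K Ω u ∧ ∫⁻ x in Ω, (‖fderiv ℝ u x‖₊ : ℝ≥0∞) ^ p ∂μ < c := by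
  simp only [capHKMCompact, iInf_lt_iff] at h
  obtain ⟨u, hu, h⟩ := h
  exact ⟨u, hu, h⟩

lemma capHKMCompact_mono {p : ℝ} {μ : Measure (EuclideanSpace ℝ (Fin n))}
    {K K' Ω : Set (EuclideanSpace ℝ (Fin n))} (h : K ⊆ K') :
    capHKMCompact p μ K Ω ≤ capHKMCompact p μ K' Ω :=
  le_iInf₂ fun _ hu => capHKMCompact_le (IsTestFunction.mono hu h)

/-- Almost minimal test functions for compact sets of almost equal capacity have almost equal
energy densities. -/
lemma exists_lintegral_rpow_fderiv_tsub_le {p : ℝ} (hp : 1 < p)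
    (μ : Measure (EuclideanSpace ℝ (Fin n))) (Ω : Set (EuclideanSpace ℝ (Fin n)))
    (S : ℝ≥0) {e : ℝ≥0} (he : 0 < e) :
    ∃ τ : ℝ≥0, 0 < τ ∧ ∀ (K : Set (EuclideanSpace ℝ (Fin n)))
      (u v : EuclideanSpace ℝ (Fin n) → ℝ), IsTestFunction K Ω u → IsTestFunction K Ω v →
      (S : ℝ≥0∞) ≤ capHKMCompact p μ K Ω + τ →
      ∫⁻ x in Ω, (‖fderiv ℝ u x‖₊ : ℝ≥0∞) ^ p ∂μ ≤ S + τ →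
      ∫⁻ x in Ω, (‖fderiv ℝ v x‖₊ : ℝ≥0∞) ^ p ∂μ ≤ S + τ →
      ∫⁻ x in Ω, ((‖fderiv ℝ v x‖₊ : ℝ≥0∞) ^ p - (‖fderiv ℝ u x‖₊ : ℝ≥0∞) ^ p) ∂μ ≤ e := by
  have hp0 : 0 ≤ p := by linarith
  set θ : ℝ≥0 := e / (4 * (S + 1)) with hθ
  have hθ0 : 0 < θ := by positivity
  obtain ⟨C, hC⟩ := exists_rpow_tsub_add_mul_le hp hθ0
  set τ : ℝ≥0 := min 1 (e / (4 * (C + 1))) with hτ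
  have hτ0 : 0 < τ := by positivity
  refine ⟨τ, hτ0, fun K u v hu hv hK hIu hIv => ?_⟩
  set a : EuclideanSpace ℝ (Fin n) → ℝ≥0∞ := fun x => (‖fderiv ℝ u x‖₊ : ℝ≥0∞) ^ p with ha
  set b : EuclideanSpace ℝ (Fin n) → ℝ≥0∞ := fun x => (‖fderiv ℝ v x‖₊ : ℝ≥0∞) ^ p with hb
  have ham : Measurable a := hu.measurable_nnnorm_fderiv.pow_const p
  have hbm : Measurable b := hv.measurable_nnnorm_fderiv.pow_const p
  have hbam : Measurable fun x => b x - a x := hbm.sub ham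
  have habm : Measurable fun x => (θ : ℝ≥0∞) * (a x + b x) := (ham.add hbm).const_mul _
  have hmid : capHKMCompact p μ K Ω ≤
      ∫⁻ x in Ω, (((‖fderiv ℝ u x‖₊ + ‖fderiv ℝ v x‖₊) / 2 : ℝ≥0) : ℝ≥0∞) ^ p ∂μ := by
    refine (capHKMCompact_le (hu.midpoint hv)).trans (lintegral_mono fun x => ?_)
    refine ENNReal.rpow_le_rpow (ENNReal.coe_le_coe.2 ?_) hp0
    rw [fderiv_const_mul ((hu.differentiable x).fun_add (hv.differentiable x)),
      fderiv_fun_add (hu.differentiable x) (hv.differentiable x), nnnorm_smul]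
    have : ‖(1 / 2 : ℝ)‖₊ = 1 / 2 := by
      rw [← NNReal.coe_inj]; simp
    rw [this, one_div, ← div_eq_inv_mul]
    gcongr
    exact nnnorm_add_le _ _
  have hint : (∫⁻ x in Ω, (b x - a x) ∂μ) + C * capHKMCompact p μ K Ω ≤
      θ * ((S + τ) + (S + τ)) + C * (((S + τ) + (S + τ)) / 2) := by
    calc (∫⁻ x in Ω, (b x - a x) ∂μ) + C * capHKMCompact p μ K Ω
        ≤ (∫⁻ x in Ω, (b x - a x) ∂μ) + C *
          ∫⁻ x in Ω, (((‖fderiv ℝ u x‖₊ + ‖fderiv ℝ v x‖₊) / 2 : ℝ≥0) : ℝ≥0∞) ^ p ∂μ := by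
          gcongr
      _ = ∫⁻ x in Ω, ((b x - a x) + C *
          (((‖fderiv ℝ u x‖₊ + ‖fderiv ℝ v x‖₊) / 2 : ℝ≥0) : ℝ≥0∞) ^ p) ∂μ := by
          rw [lintegral_add_left hbam, lintegral_const_mul' _ _ ENNReal.coe_ne_top]
      _ ≤ ∫⁻ x in Ω, (θ * (a x + b x) + C * ((a x + b x) / 2)) ∂μ :=
          lintegral_mono fun x => hC _ _
      _ = θ * ((∫⁻ x in Ω, a x ∂μ) + ∫⁻ x in Ω, b x ∂μ) +
          C * (((∫⁻ x in Ω, a x ∂μ) + ∫⁻ x in Ω, b x ∂μ) / 2) := by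
          rw [lintegral_add_left habm,
            lintegral_const_mul' _ _ ENNReal.coe_ne_top,
            lintegral_const_mul' _ _ ENNReal.coe_ne_top]
          simp only [div_eq_mul_inv]
          rw [lintegral_mul_const' _ _ (by simp), lintegral_add_left ham]
      _ ≤ _ := by gcongr
  have hS : (∫⁻ x in Ω, (b x - a x) ∂μ) + C * S ≤ e + C * S := by
    calc (∫⁻ x in Ω, (b x - a x) ∂μ) + C * S
        ≤ (∫⁻ x in Ω, (b x - a x) ∂μ) + C * (capHKMCompact p μ K Ω + τ) := by gcongr
      _ = ((∫⁻ x in Ω, (b x - a x) ∂μ) + C * capHKMCompact p μ K Ω) + C * τ := by ring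
      _ ≤ (θ * ((S + τ) + (S + τ)) + C * (((S + τ) + (S + τ)) / 2)) + C * τ := by gcongr
      _ = ((θ * ((S + τ) + (S + τ)) + C * (S + τ) + C * τ : ℝ≥0) : ℝ≥0∞) := by
          rw [ENNReal.add_div, ENNReal.add_halves]
          push_cast
          rfl
      _ ≤ ((e + C * S : ℝ≥0) : ℝ≥0∞) := by
          rw [ENNReal.coe_le_coe, ← NNReal.coe_le_coe]
          have h1 : (τ : ℝ) ≤ 1 := by exact_mod_cast min_le_left _ _
          have h2 : (τ : ℝ) ≤ e / (4 * (C + 1)) := by exact_mod_cast min_le_right _ _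
          have h3 : (θ : ℝ) * (4 * (S + 1)) = e := by
            rw [hθ]; push_cast; field_simp
          have h4 : (τ : ℝ) * (4 * (C + 1)) ≤ e := (le_div_iff₀ (by positivity)).1 h2
          push_cast
          have h5 : (θ : ℝ) * τ ≤ θ * 1 := mul_le_mul_of_nonneg_left h1 θ.2
          have h6 : (0 : ℝ) ≤ τ := τ.2
          nlinarith
      _ = e + C * S := by push_cast; rfl
  exact (ENNReal.add_le_add_iff_right (by finiteness)).1 hS

/-- Truncation of a real number to `[0, 1]`. -/
def clip (r : ℝ) : ℝ := max 0 (min 1 r)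

lemma clip_nonneg (r : ℝ) : 0 ≤ clip r := le_max_left _ _

lemma clip_le_one (r : ℝ) : clip r ≤ 1 := max_le zero_le_one (min_le_left _ _)

lemma clip_of_one_le {r : ℝ} (h : 1 ≤ r) : clip r = 1 := by simp [clip, h]

lemma clip_zero : clip 0 = 0 := by simp [clip]

lemma continuous_clip : Continuous clip := by unfold clip; fun_prop

lemma clip_le_add (a b : ℝ) : clip a ≤ clip b + |a - b| := by
  have h1 := le_abs_self (a - b)
  have h2 := abs_nonneg (a - b)
  unfold clip
  rcases max_cases 0 (min 1 a) with h | h <;> rcases max_cases 0 (min 1 b) with h' | h' <;>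
    rcases min_cases 1 a with h'' | h'' <;> rcases min_cases 1 b with h3 | h3 <;> linarith

section

variable {X : Type*} [MetricSpace X]

lemma ugDiff_coe_s16 (a b : ℝ) : ugDiff (a : EReal) (b : EReal) = ENNReal.ofReal |a - b| := by
  rw [ugDiff, ← EReal.coe_sub, EReal.abs_def, EReal.abs_def, EReal.abs_def]
  simp

/-- The supremum of a sequence of truncated functions, all of which vary along `γ` by at most
the integral of `g`, satisfies the upper gradient inequality. -/
lemma ugOn_iSup_clip {u : ℕ → X → ℝ} {g : X → ℝ≥0∞} {γ : Curve X}
    (h : ∀ i, ENNReal.ofReal |u i (γ.toFun γ.len) - u i (γ.toFun 0)| ≤ γ.integral g) :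
    UGOn (fun x => ((⨆ i, clip (u i x) : ℝ) : EReal)) g γ := by
  rw [UGOn, ugDiff_coe_s16]
  rcases eq_or_ne (γ.integral g) ⊤ with hJ | hJ
  · rw [hJ]
    exact le_top
  rw [ENNReal.ofReal_le_iff_le_toReal hJ]
  have hb : ∀ x, BddAbove (range fun i => clip (u i x)) := fun x =>
    ⟨1, by rintro _ ⟨i, rfl⟩; exact clip_le_one _⟩
  have key : ∀ x y, (∀ i, |u i x - u i y| ≤ (γ.integral g).toReal) →
      (⨆ i, clip (u i x)) - (⨆ i, clip (u i y)) ≤ (γ.integral g).toReal := by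
    intro x y hxy
    rw [sub_le_iff_le_add']
    refine ciSup_le fun i => ?_
    have h1 := clip_le_add (u i x) (u i y)
    have h2 : clip (u i y) ≤ ⨆ i, clip (u i y) := le_ciSup (hb y) i
    linarith [hxy i]
  have h' : ∀ i, |u i (γ.toFun γ.len) - u i (γ.toFun 0)| ≤ (γ.integral g).toReal := fun i =>
    (ENNReal.ofReal_le_iff_le_toReal hJ).1 (h i)
  refine abs_le'.2 ⟨key _ _ fun i => ?_, ?_⟩
  · rw [abs_sub_comm]
    exact h' i
  · rw [neg_sub]
    exact key _ _ h'

lemma IsUpperGradient.isWeakUpperGradient [MeasurableSpace X] {p : ℝ} (hp : 0 < p)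
    (μ : Measure X) {f : X → EReal} {g : X → ℝ≥0∞} (h : IsUpperGradient f g) :
    IsWeakUpperGradient p μ f g := by
  refine ⟨h.1, fun _ => 0, measurable_const, by simp [hp], fun γ hγ => ?_⟩
  exact absurd (h.2 γ) hγ

end

lemma IsTestFunction.isUpperGradient_along {K Ω : Set (EuclideanSpace ℝ (Fin n))}
    {u : EuclideanSpace ℝ (Fin n) → ℝ} (hu : IsTestFunction K Ω u)
    (γ : Curve (EuclideanSpace ℝ (Fin n))) :
    ENNReal.ofReal |u (γ.toFun γ.len) - u (γ.toFun 0)| ≤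
      γ.integral fun x => (‖fderiv ℝ u x‖₊ : ℝ≥0∞) := by
  have := abs_sub_le_lintegral_fderiv hu.contDiff_one γ.lipschitzWith_extend γ.len_pos.le
  rw [γ.extend_of_mem ⟨γ.len_pos.le, le_rfl⟩, γ.extend_of_mem ⟨le_rfl, γ.len_pos.le⟩] at this
  refine this.trans_eq (setLIntegral_congr_fun measurableSet_Icc fun t ht => ?_)
  simp only [γ.extend_of_mem ht]

lemma le_add_tsum_tsub (a : ℕ → ℝ≥0∞) (i : ℕ) : a i ≤ a 0 + ∑' j, (a (j + 1) - a j) := by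
  have h : a i ≤ a 0 + ∑ j ∈ Finset.range i, (a (j + 1) - a j) := by
    induction i with
    | zero => simp
    | succ i ih =>
      rw [Finset.sum_range_succ, ← add_assoc]
      exact le_add_tsub.trans (add_le_add_left ih _)
  exact h.trans (add_le_add_right (ENNReal.sum_le_tsum _) _)

/-- For open `G`, the Newtonian capacity is at most the Heinonen–Kilpeläinen–Martio capacity. -/
lemma varCapacity_le_capHKMOpen {p : ℝ} (hp : 1 < p) {μ : Measure (EuclideanSpace ℝ (Fin n))}
    {Ω G A : Set (EuclideanSpace ℝ (Fin n))} (hΩbdd : Bornology.IsBounded Ω) (hΩ : IsOpen Ω)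
    (hμΩ : μ Ω < ⊤) (hG : IsOpen G) (hGΩ : G ⊆ Ω) (hAG : A ⊆ G) :
    varCapacity p μ A Ω ≤ capHKMOpen p μ G Ω := by
  have hp0 : 0 < p := by linarith
  obtain ⟨F, hFc, hFG, hFU, hFm⟩ := hG.exists_iUnion_isClosed
  have hFcomp : ∀ j, IsCompact (F j) := fun j =>
    isCompact_of_isClosed_isBounded (hFc j) (hΩbdd.subset ((hFG j).trans hGΩ))
  set d : ℕ → ℝ≥0∞ := fun j => capHKMCompact p μ (F j) Ω with hd
  have hdm : Monotone d := fun i j hij => capHKMCompact_mono (hFm hij)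
  have hdle : ⨆ j, d j ≤ capHKMOpen p μ G Ω := iSup_le fun j =>
    le_iSup₂_of_le (F j) ⟨hFcomp j, hFG j⟩ le_rfl
  refine le_trans ?_ hdle
  refine ENNReal.le_of_forall_pos_le_add fun e he htop => ?_
  obtain ⟨S, hS⟩ : ∃ S : ℝ≥0, (S : ℝ≥0∞) = ⨆ j, d j := ⟨_, ENNReal.coe_toNNReal htop.ne⟩
  obtain ⟨ε, hε0, hεsum⟩ := ENNReal.exists_pos_sum_of_countable
    (ε := ((e / 2 : ℝ≥0) : ℝ≥0∞)) (by positivity) ℕ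
  choose τ hτ0 hτ using fun i => exists_lintegral_rpow_fderiv_tsub_le hp μ Ω S (hε0 i)
  obtain ⟨φ, hφ, hdφ⟩ : ∃ φ : ℕ → ℕ, StrictMono φ ∧ ∀ i, (S : ℝ≥0∞) ≤ d (φ i) + τ i := by
    refine extraction_forall_of_eventually
      (P := fun i k => (S : ℝ≥0∞) ≤ d k + τ i) fun i => ?_
    have hlt : (⨆ j, d j) < (⨆ j, d j) + τ i :=
      ENNReal.lt_add_right htop.ne (by exact_mod_cast (hτ0 i).ne')
    have ht := (tendsto_atTop_iSup hdm).add_const (τ i : ℝ≥0∞)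
    filter_upwards [ht.eventually_const_lt hlt] with k hk
    rw [hS]
    exact hk.le
  set σ : ℕ → ℝ≥0 := fun i => min (e / 2) (min (τ i) (τ (i - 1))) with hσ
  have hσ0 : ∀ i, 0 < σ i := fun i => by
    have := hτ0 i
    have := hτ0 (i - 1)
    positivity
  choose u hu hIu using fun i => exists_isTestFunction_of_capHKMCompact_lt
    (c := S + σ i) (K := F (φ i)) (p := p) (μ := μ) (Ω := Ω) <| by
      refine (le_iSup d (φ i)).trans_lt ?_
      rw [← hS]
      exact ENNReal.lt_add_right ENNReal.coe_ne_top (by exact_mod_cast (hσ0 i).ne')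
  set a : ℕ → EuclideanSpace ℝ (Fin n) → ℝ≥0∞ :=
    fun i x => (‖fderiv ℝ (u i) x‖₊ : ℝ≥0∞) ^ p with ha
  have ham : ∀ i, Measurable (a i) := fun i => (hu i).measurable_nnnorm_fderiv.pow_const p
  have hsubm : ∀ i, Measurable fun x => a (i + 1) x - a i x := fun i => (ham (i + 1)).sub (ham i)
  have hdiff : ∀ i, ∫⁻ x in Ω, (a (i + 1) x - a i x) ∂μ ≤ ε i := by
    intro i
    refine hτ i (F (φ i)) (u i) (u (i + 1)) (hu i)
      ((hu (i + 1)).mono (hFm (hφ.monotone i.le_succ))) (hdφ i) ?_ ?_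
    · refine (hIu i).le.trans ?_
      gcongr
      exact (min_le_right _ _).trans (min_le_left _ _)
    · refine (hIu (i + 1)).le.trans ?_
      gcongr
      exact (min_le_right _ _).trans (min_le_right _ _)
  set H : EuclideanSpace ℝ (Fin n) → ℝ≥0∞ := fun x => a 0 x + ∑' i, (a (i + 1) x - a i x) with hH
  have hHm : Measurable H :=
    (ham 0).add (Measurable.tsum hsubm)
  have hfd : ∀ i, ∀ x ∉ Ω, fderiv ℝ (u i) x = 0 := fun i x hx =>
    image_eq_zero_of_notMem_tsupport fun h => hx ((hu i).2.2.1 (tsupport_fderiv_subset ℝ h))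
  have hHsupp : Function.support H ⊆ Ω := by
    intro x hx
    by_contra hxΩ
    refine hx ?_
    simp [hH, ha, hfd _ x hxΩ, hp0]
  have hHint : ∫⁻ x, H x ∂μ ≤ S + e := by
    rw [← setLIntegral_eq_of_support_subset hHsupp, hH, lintegral_add_left (ham 0),
      lintegral_tsum fun i => (hsubm i).aemeasurable]
    calc (∫⁻ x in Ω, a 0 x ∂μ) + ∑' i, ∫⁻ x in Ω, (a (i + 1) x - a i x) ∂μ
        ≤ (S + σ 0) + ∑' i, (ε i : ℝ≥0∞) :=
          add_le_add (hIu 0).le (ENNReal.tsum_le_tsum hdiff)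
      _ ≤ (S + (e / 2 : ℝ≥0)) + (e / 2 : ℝ≥0) := by
          gcongr
          exact min_le_left _ _
      _ = S + e := by
          rw [add_assoc, ← ENNReal.coe_add, add_halves]
  set g : EuclideanSpace ℝ (Fin n) → ℝ≥0∞ := fun x => H x ^ p⁻¹ with hg
  have hgp : ∀ x, g x ^ p = H x := fun x => ENNReal.rpow_inv_rpow hp0.ne' _
  set w : EuclideanSpace ℝ (Fin n) → ℝ := fun x => ⨆ i, clip (u i x) with hw
  have hug : IsUpperGradient (fun x => (w x : EReal)) g := by
    refine ⟨hHm.pow_const _, fun γ => ugOn_iSup_clip fun i => ?_⟩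
    refine ((hu i).isUpperGradient_along γ).trans (lintegral_mono fun t => ?_)
    have h1 : a i (γ.toFun t) ≤ H (γ.toFun t) := le_add_tsum_tsub (fun i => a i (γ.toFun t)) i
    calc (‖fderiv ℝ (u i) (γ.toFun t)‖₊ : ℝ≥0∞) = a i (γ.toFun t) ^ p⁻¹ :=
          (ENNReal.rpow_rpow_inv hp0.ne' _).symm
      _ ≤ _ := ENNReal.rpow_le_rpow h1 (by positivity)
  have henergy : gradEnergy p μ (fun x => (w x : EReal)) ≤ S + e := by
    refine (iInf₂_le g (hug.isWeakUpperGradient hp0 μ)).trans ?_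
    simp only [hgp]
    exact hHint
  have hwm : Measurable w :=
    Measurable.iSup fun i => continuous_clip.measurable.comp (hu i).1.continuous.measurable
  have hwb : ∀ x, BddAbove (range fun i => clip (u i x)) := fun x =>
    ⟨1, by rintro _ ⟨i, rfl⟩; exact clip_le_one _⟩
  have hw0 : ∀ x, 0 ≤ w x := fun x => Real.iSup_nonneg fun i => clip_nonneg _
  have hw1 : ∀ x, w x ≤ 1 := fun x => ciSup_le fun i => clip_le_one _
  have hwΩ : ∀ x ∉ Ω, w x = 0 := by
    intro x hx
    have : ∀ i, u i x = 0 := fun i =>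
      image_eq_zero_of_notMem_tsupport fun h => hx ((hu i).2.2.1 h)
    simp [hw, this, clip_zero]
  rw [← hS]
  refine (iInf₂_le (fun x => (w x : EReal)) ⟨⟨⟨?_, ?_⟩, ?_⟩, ?_⟩).trans henergy
  · exact (measurable_coe_real_ereal.comp hwm).aemeasurable
  · refine ENNReal.add_lt_top.2 ⟨?_, henergy.trans_lt (by finiteness)⟩
    calc ∫⁻ x, (w x : EReal).abs ^ p ∂μ ≤ ∫⁻ x, Ω.indicator 1 x ∂μ := by
          refine lintegral_mono fun x => ?_
          by_cases hx : x ∈ Ω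
          · rw [indicator_of_mem hx, EReal.abs_def, abs_of_nonneg (hw0 x), Pi.one_apply]
            exact ENNReal.rpow_le_one (by simpa using hw1 x) hp0.le
          · simp [hx, hwΩ x hx, hp0]
      _ = μ Ω := by rw [lintegral_indicator_one hΩ.measurableSet]
      _ < ⊤ := hμΩ
  · intro x hx
    simp [hwΩ x hx]
  · intro x hx
    obtain ⟨j, hj⟩ := mem_iUnion.1 (hFU ▸ hAG hx : x ∈ ⋃ j, F j)
    have h1 : 1 ≤ u j x := (hu j).2.2.2 x (hFm (hφ.id_le j) hj)
    have h2 : clip (u j x) ≤ w x := le_ciSup (hwb x) j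
    rw [clip_of_one_le h1] at h2
    change (1 : EReal) ≤ ((w x : ℝ) : EReal)
    exact_mod_cast h2

/-! ### Exit paths and the exit cost -/

section ExitCost

variable {E : Type*} [NormedAddCommGroup E]

/-- A `1`-Lipschitz path starting at `x` and lying outside `Ω` at time `T`. -/
def IsExitPath (Ω : Set E) (x : E) (γ : ℝ → E) (T : ℝ) : Prop :=
  LipschitzWith 1 γ ∧ 0 ≤ T ∧ γ 0 = x ∧ γ T ∉ Ω

/-- The infimum of the costs of exit paths from `x` with respect to the density `g`. -/
def exitCost (Ω : Set E) (g : E → ℝ≥0∞) (x : E) : ℝ≥0∞ :=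
  ⨅ (γ : ℝ → E) (T : ℝ) (_ : IsExitPath Ω x γ T), ∫⁻ t in Icc 0 T, g (γ t)

lemma exitCost_le {Ω : Set E} {g : E → ℝ≥0∞} {x : E} {γ : ℝ → E} {T : ℝ}
    (h : IsExitPath Ω x γ T) : exitCost Ω g x ≤ ∫⁻ t in Icc 0 T, g (γ t) :=
  iInf_le_of_le γ (iInf₂_le T h)

lemma exists_isExitPath_of_exitCost_lt {Ω : Set E} {g : E → ℝ≥0∞} {x : E} {a : ℝ≥0∞}
    (h : exitCost Ω g x < a) :
    ∃ γ T, IsExitPath Ω x γ T ∧ ∫⁻ t in Icc 0 T, g (γ t) < a := by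
  simp only [exitCost, iInf_lt_iff] at h
  obtain ⟨γ, T, h1, h2⟩ := h
  exact ⟨γ, T, h1, h2⟩

lemma exitCost_eq_zero {Ω : Set E} {x : E} (hx : x ∉ Ω) (g : E → ℝ≥0∞) : exitCost Ω g x = 0 := by
  refine le_antisymm ?_ zero_le
  refine (exitCost_le (γ := fun _ => x) (T := 0)
    ⟨LipschitzWith.const' x, le_rfl, rfl, hx⟩).trans ?_
  simp

lemma exitCost_mono {Ω : Set E} {g h : E → ℝ≥0∞} (hgh : ∀ x, g x ≤ h x) (x : E) :
    exitCost Ω g x ≤ exitCost Ω h x :=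
  iInf_mono fun _ => iInf_mono fun _ => iInf_mono fun _ => lintegral_mono fun _ => hgh _

lemma exitCost_le_mul_edist_add [NormedSpace ℝ E] {Ω : Set E} {g : E → ℝ≥0∞} {x y : E} {s : ℝ≥0∞}
    (hs : ∀ z ∈ segment ℝ x y, g z ≤ s) :
    exitCost Ω g x ≤ s * edist x y + exitCost Ω g y := by
  rcases eq_or_ne x y with rfl | hxy
  · simp
  have hd : 0 < dist x y := dist_pos.2 hxy
  set d := dist x y with hd_def
  conv_rhs => rw [exitCost]
  simp only [ENNReal.add_iInf]
  refine le_iInf fun γ => le_iInf fun T => le_iInf fun ⟨hγ, hT, h0, hTΩ⟩ => ?_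
  set η : ℝ → E := fun t => x + (max 0 (min t d) / d) • (y - x) + (γ (max (t - d) 0) - y) with hη
  have hηL : LipschitzWith 1 η := by
    have key : ∀ s t : ℝ, s ≤ t → dist (η s) (η t) ≤ t - s := by
      intro s t hst
      have h1 : dist (η s) (η t) ≤ |max 0 (min s d) - max 0 (min t d)| +
          |max (s - d) 0 - max (t - d) 0| := by
        have e1 : η s - η t = ((max 0 (min s d) - max 0 (min t d)) / d) • (y - x) +
            (γ (max (s - d) 0) - γ (max (t - d) 0)) := by
          simp only [hη, sub_div, sub_smul]; abel
        rw [dist_eq_norm, e1]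
        refine (norm_add_le _ _).trans (add_le_add ?_ ?_)
        · rw [norm_smul, ← dist_eq_norm, dist_comm y x, ← hd_def, Real.norm_eq_abs, abs_div,
            abs_of_pos hd, div_mul_cancel₀ _ hd.ne']
        · rw [← dist_eq_norm]
          simpa [Real.dist_eq] using hγ.dist_le_mul (max (s - d) 0) (max (t - d) 0)
      refine h1.trans ?_
      have m1 : max 0 (min s d) ≤ max 0 (min t d) := by gcongr
      have m2 : max (s - d) 0 ≤ max (t - d) 0 := by gcongr
      rw [abs_of_nonpos (by linarith), abs_of_nonpos (by linarith)]
      have hsum : ∀ r : ℝ, max 0 (min r d) + max (r - d) 0 = max r 0 := by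
        intro r
        rcases le_total r d with a | a
        · rw [min_eq_left a, max_eq_right (sub_nonpos.2 a), add_zero, max_comm]
        · rw [min_eq_right a, max_eq_left (sub_nonneg.2 a), max_eq_right hd.le,
            max_eq_left (hd.le.trans a), add_sub_cancel]
      have m3 : max t 0 ≤ max s 0 + (t - s) :=
        max_le (by linarith [le_max_left s 0]) (by linarith [le_max_right s 0])
      linarith [hsum s, hsum t]
    refine LipschitzWith.of_dist_le_mul fun s t => ?_
    rw [NNReal.coe_one, one_mul, Real.dist_eq]
    rcases le_total s t with h | h
    · rw [abs_sub_comm, abs_of_nonneg (by linarith)]; exact key s t h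
    · rw [dist_comm, abs_of_nonneg (by linarith)]; exact key t s h
  have hη1 : ∀ t ∈ Icc 0 d, η t ∈ segment ℝ x y := by
    intro t ht
    rw [segment_eq_image']
    refine ⟨t / d, ⟨div_nonneg ht.1 hd.le, (div_le_one hd).2 ht.2⟩, ?_⟩
    simp [hη, ht.1, ht.2, h0]
  have hη2 : ∀ t, 0 ≤ t → η (t + d) = γ t := by
    intro t ht
    simp [hη, ht, hd.le, hd.ne']
  have hexit : IsExitPath Ω x η (T + d) := by
    refine ⟨hηL, by positivity, ?_, ?_⟩
    · simp [hη, hd.le, h0]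
    · rwa [hη2 T hT]
  refine (exitCost_le hexit).trans ?_
  have hsub : Icc 0 (T + d) ⊆ Icc 0 d ∪ Icc d (T + d) := by
    intro t ht
    rcases le_total t d with h | h
    · exact Or.inl ⟨ht.1, h⟩
    · exact Or.inr ⟨h, ht.2⟩
  refine (lintegral_mono_set hsub).trans ((lintegral_union_le _ _ _).trans (add_le_add ?_ ?_))
  · calc ∫⁻ t in Icc 0 d, g (η t) ≤ ∫⁻ _ in Icc 0 d, s :=
        setLIntegral_mono' measurableSet_Icc fun t ht => hs _ (hη1 t ht)
      _ = s * edist x y := by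
        rw [setLIntegral_const, Real.volume_Icc, sub_zero, edist_dist]
  · have hpre : (fun t : ℝ => t + d) ⁻¹' Icc d (T + d) = Icc 0 T := by
      ext t; simp
    have := (measurePreserving_add_right volume d).setLIntegral_comp_preimage_emb
      (measurableEmbedding_addRight d) (fun t => g (η t)) (Icc d (T + d))
    rw [hpre] at this
    rw [← this]
    exact (setLIntegral_congr_fun measurableSet_Icc fun t ht => by rw [hη2 t ht.1]).le

/-- If the exit costs for an increasing sequence of continuous densities stay below `a`, then some
exit path has cost at most `a` with respect to the limit density. -/
lemma exists_isExitPath_lintegral_iSup_le [ProperSpace E] {Ω : Set E} (hΩ : IsOpen Ω)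
    {G : ℕ → E → ℝ≥0} (hGc : ∀ k, Continuous (G k)) (hGm : Monotone G) {c : ℝ≥0} (hc : 0 < c)
    (hcG : ∀ k x, c ≤ G k x) {x : E} {a : ℝ≥0}
    (h : ∀ k, exitCost Ω (fun y => (G k y : ℝ≥0∞)) x < a) :
    ∃ γ T, IsExitPath Ω x γ T ∧ ∫⁻ t in Icc 0 T, ⨆ k, (G k (γ t) : ℝ≥0∞) ≤ a := by
  choose γ T hγT hcost using fun k => exists_isExitPath_of_exitCost_lt (h k)
  set M : ℝ := a / c with hM
  have hM0 : 0 ≤ M := by positivity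
  have hTM : ∀ k, T k ∈ Icc 0 M := by
    intro k
    refine ⟨(hγT k).2.1, ?_⟩
    have h1 : (c : ℝ≥0∞) * ENNReal.ofReal (T k) ≤ a := by
      calc (c : ℝ≥0∞) * ENNReal.ofReal (T k) = ∫⁻ _ in Icc 0 (T k), (c : ℝ≥0∞) := by
            rw [setLIntegral_const, Real.volume_Icc, sub_zero]
        _ ≤ ∫⁻ t in Icc 0 (T k), (G k (γ k t) : ℝ≥0∞) :=
            lintegral_mono fun t => ENNReal.coe_le_coe.2 (hcG k _)
        _ ≤ a := (hcost k).le
    rw [hM, le_div_iff₀ (by exact_mod_cast hc), mul_comm]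
    have h2 := ENNReal.toReal_mono ENNReal.coe_ne_top h1
    simpa [ENNReal.toReal_mul, ENNReal.toReal_ofReal (hγT k).2.1] using h2
  have : Fact ((0 : ℝ) ≤ M) := ⟨hM0⟩
  set z : Icc (0 : ℝ) M := ⟨0, le_rfl, hM0⟩ with hz
  set S : Set (BoundedContinuousFunction (Icc (0 : ℝ) M) E) :=
    {f | (∀ s t, dist (f s) (f t) ≤ dist s t) ∧ f z = x} with hS
  have hev : ∀ t : Icc (0 : ℝ) M,
      Continuous fun f : BoundedContinuousFunction (Icc (0 : ℝ) M) E => f t :=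
    fun t => (BoundedContinuousFunction.lipschitz_eval_const t).continuous
  have hSclosed : IsClosed S := by
    refine IsClosed.inter (s₁ := {f : BoundedContinuousFunction (Icc (0 : ℝ) M) E |
      ∀ s t, dist (f s) (f t) ≤ dist s t}) ?_ ?_
    · simp only [Set.ofPred_forall]
      exact isClosed_iInter fun s => isClosed_iInter fun t =>
        isClosed_le ((hev s).dist (hev t)) continuous_const
    · exact isClosed_eq (hev z) continuous_const
  have hScomp : IsCompact S := by
    refine BoundedContinuousFunction.arzela_ascoli₂ (closedBall x M) (isCompact_closedBall x M) S
      hSclosed ?_ ?_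
    · intro f s hf
      rw [mem_closedBall, ← hf.2]
      refine (hf.1 s z).trans ?_
      rw [Subtype.dist_eq, Real.dist_eq, hz, sub_zero, abs_of_nonneg s.2.1]
      exact s.2.2
    · refine Metric.equicontinuous_of_continuity_modulus (fun r => r) tendsto_id _ ?_
      intro s t f
      exact f.2.1 s t
  set f : ℕ → BoundedContinuousFunction (Icc (0 : ℝ) M) E := fun k =>
    BoundedContinuousFunction.mkOfCompact
      ⟨fun t => γ k t, (hγT k).1.continuous.comp continuous_subtype_val⟩ with hf
  have hfS : ∀ k, f k ∈ S := fun k =>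
    ⟨fun s t => by simpa [hf, Subtype.dist_eq] using (hγT k).1.dist_le_mul (s : ℝ) t, (hγT k).2.2.1⟩
  obtain ⟨F, hFS, φ, hφ, hlim⟩ := hScomp.tendsto_subseq hfS
  obtain ⟨T₀, hT₀, ψ, hψ, hTlim⟩ := isCompact_Icc.tendsto_subseq fun k => hTM (φ k)
  set θ : ℕ → ℕ := φ ∘ ψ with hθ
  have hθm : StrictMono θ := hφ.comp hψ
  have hlim' : Tendsto (fun k => f (θ k)) atTop (𝓝 F) := hlim.comp hψ.tendsto_atTop
  have hTlim' : Tendsto (fun k => T (θ k)) atTop (𝓝 T₀) := hTlim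
  have hpt : ∀ t (ht : t ∈ Icc 0 M), Tendsto (fun k => γ (θ k) t) atTop (𝓝 (F ⟨t, ht⟩)) :=
    fun t ht => ((hev ⟨t, ht⟩).tendsto F).comp hlim'
  set η : ℝ → E := fun t => F (projIcc 0 M hM0 t) with hη
  have hηt : ∀ t (ht : t ∈ Icc 0 M), η t = F ⟨t, ht⟩ := fun t ht => by
    simp only [hη, projIcc_of_mem hM0 ht]
  have hηL : LipschitzWith 1 η :=
    (LipschitzWith.mk_one hFS.1).comp (LipschitzWith.projIcc hM0) |>.weaken (by simp)
  refine ⟨η, T₀, ⟨hηL, hT₀.1, ?_, ?_⟩, ?_⟩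
  · rw [hηt 0 ⟨le_rfl, hM0⟩]; exact hFS.2
  · have h1 : Tendsto (fun k => γ (θ k) (T (θ k))) atTop (𝓝 (η T₀)) := by
      rw [hηt T₀ hT₀]
      have h2 := hpt T₀ hT₀
      refine h2.congr_dist ?_
      refine squeeze_zero (fun _ => dist_nonneg)
        (fun k => by simpa using (hγT (θ k)).1.dist_le_mul T₀ (T (θ k))) ?_
      have := (tendsto_const_nhds (x := T₀)).dist hTlim'
      rwa [dist_self] at this
    exact hΩ.isClosed_compl.mem_of_tendsto h1 (Eventually.of_forall fun k => (hγT (θ k)).2.2.2)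
  · have hmeas : ∀ m (κ : ℝ → E), Continuous κ → Measurable fun t => (G m (κ t) : ℝ≥0∞) :=
      fun m κ hκ => (ENNReal.continuous_coe.comp ((hGc m).comp hκ)).measurable
    rw [lintegral_iSup (fun m => hmeas m η hηL.continuous)
      (fun i j hij t => ENNReal.coe_le_coe.2 (hGm hij _))]
    refine iSup_le fun m => ?_
    rw [setLIntegral_congr Ico_ae_eq_Icc.symm, ← lintegral_indicator measurableSet_Ico]
    have hle : ∀ t, (Ico 0 T₀).indicator (fun t => (G m (η t) : ℝ≥0∞)) t ≤
        liminf (fun k => (Icc 0 (T (θ k))).indicator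
          (fun t => (G m (γ (θ k) t) : ℝ≥0∞)) t) atTop := by
      intro t
      by_cases ht : t ∈ Ico 0 T₀
      · rw [indicator_of_mem ht]
        have htM : t ∈ Icc 0 M := ⟨ht.1, ht.2.le.trans hT₀.2⟩
        have h1 : Tendsto (fun k => (G m (γ (θ k) t) : ℝ≥0∞)) atTop (𝓝 (G m (η t) : ℝ≥0∞)) := by
          rw [hηt t htM]
          exact ((ENNReal.continuous_coe.comp (hGc m)).tendsto _).comp (hpt t htM)
        refine (h1.congr' ?_).liminf_eq.ge
        filter_upwards [hTlim'.eventually_const_lt ht.2] with k hk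
        rw [indicator_of_mem]
        exact ⟨ht.1, hk.le⟩
      · rw [indicator_of_notMem ht]; exact zero_le
    refine (lintegral_mono hle).trans ((lintegral_liminf_le fun k =>
      (hmeas m _ (hγT (θ k)).1.continuous).indicator measurableSet_Icc).trans ?_)
    refine liminf_le_of_le (by isBoundedDefault) fun b hb => ?_
    obtain ⟨k, hk, hmk⟩ := (hb.and (eventually_ge_atTop m)).exists
    refine hk.trans ?_
    rw [lintegral_indicator measurableSet_Icc]
    refine le_trans (lintegral_mono fun t => ?_) (hcost (θ k)).le
    exact ENNReal.coe_le_coe.2 (hGm (hmk.trans (hθm.id_le k)) _)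

/-- A lower semicontinuous function is the limit of an increasing sequence of bounded Lipschitz
functions. -/
lemma exists_monotone_lipschitz_iSup_eq {E : Type*} [PseudoEMetricSpace E] {g : E → ℝ≥0∞}
    (hg : LowerSemicontinuous g) {c : ℝ≥0} (hc : ∀ x, c ≤ g x) :
    ∃ G : ℕ → E → ℝ≥0, (∀ k : ℕ, LipschitzWith k (G k)) ∧ (∀ k x, G k x ≤ c + k) ∧ Monotone G ∧
      (∀ k x, c ≤ G k x) ∧ ∀ x, ⨆ k, (G k x : ℝ≥0∞) = g x := by
  set B : ℕ → E → ℝ≥0∞ := fun k x => ⨅ y, (min (g y) (c + k) + k * edist x y) with hB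
  have hB1 : ∀ k x, B k x ≤ min (g x) (c + k) := fun k x =>
    (iInf_le _ x).trans (by simp)
  have hBtop : ∀ k x, B k x ≠ ⊤ := fun k x =>
    (((hB1 k x).trans (min_le_right _ _)).trans_lt (by finiteness)).ne
  have hcoe : ∀ k x, ((B k x).toNNReal : ℝ≥0∞) = B k x := fun k x => ENNReal.coe_toNNReal (hBtop k x)
  have hBl : ∀ k x y, B k x ≤ B k y + k * edist x y := by
    intro k x y
    simp only [hB, ENNReal.iInf_add]
    refine le_iInf fun z => (iInf_le _ z).trans ?_
    rw [add_assoc, ← mul_add, add_comm (edist y z)]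
    gcongr
    exact edist_triangle _ _ _
  refine ⟨fun k x => (B k x).toNNReal, fun k x y => ?_, fun k x => ?_, fun i j hij x => ?_,
    fun k x => ?_, fun x => ?_⟩
  · rw [edist_nndist, NNReal.nndist_eq, ENNReal.coe_max, ENNReal.coe_sub, ENNReal.coe_sub, hcoe,
      hcoe]
    refine max_le (tsub_le_iff_left.2 (hBl k x y)) (tsub_le_iff_left.2 ?_)
    rw [edist_comm]
    exact hBl k y x
  · rw [← ENNReal.coe_le_coe, hcoe]
    push_cast
    exact (hB1 k x).trans (min_le_right _ _)
  · rw [← ENNReal.coe_le_coe, hcoe, hcoe]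
    refine iInf_mono fun y => ?_
    gcongr
  · rw [← ENNReal.coe_le_coe, hcoe]
    refine le_iInf fun y => le_add_right (le_min (hc y) (by simp))
  · simp only [hcoe]
    refine le_antisymm (iSup_le fun k => (hB1 k x).trans (min_le_left _ _)) ?_
    refine ENNReal.le_of_forall_nnreal_lt fun r hr => ?_
    obtain ⟨δ, hδ, hball⟩ := EMetric.mem_nhds_iff.1 (hg x r hr)
    obtain ⟨k₁, hk₁⟩ := ENNReal.exists_nat_gt (ENNReal.coe_ne_top (r := r))
    obtain ⟨k₂, hk₂⟩ := ENNReal.exists_nat_mul_gt hδ.ne' (ENNReal.coe_ne_top (r := r))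
    refine le_iSup_of_le (max k₁ k₂) (le_iInf fun y => ?_)
    rcases lt_or_ge (edist x y) δ with h | h
    · refine le_add_right (le_min (le_of_lt (hball (by rwa [Metric.mem_eball']))) ?_)
      refine hk₁.le.trans (le_add_left ?_)
      exact_mod_cast le_max_left _ _
    · refine le_add_left (hk₂.le.trans ?_)
      gcongr
      exact_mod_cast le_max_right _ _

end ExitCost

/-! ### Mollification -/

open scoped Convolution in
lemma ContDiffBump.norm_normed_convolution_sub_le (φ : ContDiffBump (0 : EuclideanSpace ℝ (Fin n)))
    {f : EuclideanSpace ℝ (Fin n) → ℝ} (hf : Continuous f) {x y : EuclideanSpace ℝ (Fin n)} {C : ℝ}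
    (h : ∀ t ∈ ball (0 : EuclideanSpace ℝ (Fin n)) φ.rOut, |f (y - t) - f (x - t)| ≤ C) :
    |(φ.normed volume ⋆[ContinuousLinearMap.lsmul ℝ ℝ, volume] f) y -
      (φ.normed volume ⋆[ContinuousLinearMap.lsmul ℝ ℝ, volume] f) x| ≤ C := by
  have hint : ∀ z, Integrable fun t => φ.normed volume t * f (z - t) := fun z =>
    (φ.continuous_normed.mul (by fun_prop)).integrable_of_hasCompactSupport
      φ.hasCompactSupport_normed.mul_right
  simp only [convolution_def, ContinuousLinearMap.lsmul_apply, smul_eq_mul]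
  rw [← integral_sub (hint y) (hint x), ← Real.norm_eq_abs]
  have hC : ∫ t, φ.normed volume t * C = C := by
    rw [integral_mul_const, φ.integral_normed, one_mul]
  refine (norm_integral_le_of_norm_le (φ.integrable_normed.mul_const C)
    (Eventually.of_forall fun t => ?_)).trans_eq hC
  rw [← mul_sub, norm_mul, Real.norm_eq_abs, Real.norm_eq_abs, abs_of_nonneg (φ.nonneg_normed t)]
  by_cases ht : t ∈ ball (0 : EuclideanSpace ℝ (Fin n)) φ.rOut
  · exact mul_le_mul_of_nonneg_left (h t ht) (φ.nonneg_normed t)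
  · rw [← φ.support_normed_eq (μ := volume), Function.notMem_support] at ht
    simp [ht]

lemma exists_isTestFunction_norm_fderiv_le {Ω : Set (EuclideanSpace ℝ (Fin n))}
    (hΩ : Bornology.IsBounded Ω) {F : EuclideanSpace ℝ (Fin n) → ℝ} (hFΩ : ∀ x ∉ Ω, F x = 0)
    {G : EuclideanSpace ℝ (Fin n) → ℝ≥0} {L c M : ℝ≥0} (hG : LipschitzWith L G) (hc : 0 < c)
    (hcG : ∀ x, c ≤ G x) (hGM : ∀ x, G x ≤ M)
    (hFG : ∀ x y, ∀ s : ℝ≥0, (∀ z ∈ segment ℝ x y, G z ≤ s) → |F x - F y| ≤ s * dist x y)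
    {ε : ℝ} (hε : 0 < ε) (hε3 : 3 * ε < 1) :
    ∃ u, IsTestFunction {x | 1 - ε < F x} Ω u ∧
      ∀ x, ‖fderiv ℝ u x‖ ≤ (1 + ε) / (1 - 3 * ε) * G x := by
  have hFL : LipschitzWith M F := LipschitzWith.of_dist_le_mul fun x y =>
    hFG x y M fun z _ => hGM z
  set F₀ : EuclideanSpace ℝ (Fin n) → ℝ := fun x => max (F x - ε) 0 with hF₀
  have hF₀F : ∀ x y, |F₀ x - F₀ y| ≤ |F x - F y| := fun x y => by
    simpa [hF₀] using abs_max_sub_max_le_abs (F x - ε) (F y - ε) 0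
  have hF₀c : Continuous F₀ := (hFL.continuous.sub continuous_const).max continuous_const
  obtain ⟨δ, hδ0, hδM, hδL⟩ : ∃ δ : ℝ, 0 < δ ∧ M * δ ≤ ε / 2 ∧ L * (2 * δ) ≤ ε * c := by
    have hc' : (0 : ℝ) < c := by exact_mod_cast hc
    refine ⟨min (ε / (2 * (M + 1))) (ε * c / (2 * (L + 1))), by positivity, ?_, ?_⟩
    · have h1 : min (ε / (2 * ((M : ℝ) + 1))) (ε * c / (2 * (L + 1))) * (2 * (M + 1)) ≤ ε :=
        (le_div_iff₀ (by positivity)).1 (min_le_left _ _)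
      have h2 : 0 < min (ε / (2 * ((M : ℝ) + 1))) (ε * c / (2 * (L + 1))) := by positivity
      nlinarith
    · have h1 : min (ε / (2 * ((M : ℝ) + 1))) (ε * c / (2 * (L + 1))) * (2 * (L + 1)) ≤ ε * c :=
        (le_div_iff₀ (by positivity)).1 (min_le_right _ _)
      have h2 : 0 < min (ε / (2 * ((M : ℝ) + 1))) (ε * c / (2 * (L + 1))) := by positivity
      nlinarith
  set φ : ContDiffBump (0 : EuclideanSpace ℝ (Fin n)) := ⟨δ / 2, δ, by positivity, by linarith⟩
    with hφ
  set v : EuclideanSpace ℝ (Fin n) → ℝ :=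
    convolution (φ.normed volume) F₀ (ContinuousLinearMap.lsmul ℝ ℝ) volume with hv
  have hvF : ∀ x, |v x - F₀ x| ≤ ε := by
    intro x
    refine φ.dist_normed_convolution_le hF₀c.aestronglyMeasurable fun y hy => ?_
    have hy' : dist y x ≤ δ := (mem_ball.1 hy).le
    rw [Real.dist_eq]
    refine (hF₀F y x).trans (le_trans (hFL.dist_le_mul y x) ?_)
    have : (M : ℝ) * dist y x ≤ M * δ := by gcongr
    linarith
  have hvC : ContDiff ℝ (⊤ : ℕ∞) v :=
    φ.hasCompactSupport_normed.contDiff_convolution_left _ φ.contDiff_normed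
      hF₀c.locallyIntegrable
  have hvsupp : tsupport v ⊆ {x | ε / 2 ≤ F x} := by
    refine closure_minimal (fun x hx => ?_) (isClosed_le continuous_const hFL.continuous)
    by_contra hcon
    rw [mem_ofPred_eq, not_le] at hcon
    refine hx ?_
    have hz : ∀ y ∈ ball x δ, F₀ y = 0 := by
      intro y hy
      have h1 : |F y - F x| ≤ M * dist y x := hFL.dist_le_mul y x
      have h2 : (M : ℝ) * dist y x ≤ M * δ := by gcongr; exact (mem_ball.1 hy).le
      have h3 := (abs_le.1 h1).2
      exact max_eq_right (by linarith)
    have hx0 : F₀ x = 0 := hz x (mem_ball_self hδ0)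
    exact (φ.normed_convolution_eq_right fun y hy => (hz y hy).trans hx0.symm).trans hx0
  have hsubΩ : {x | ε / 2 ≤ F x} ⊆ Ω := fun x hx => by
    by_contra hcon
    rw [mem_ofPred_eq, hFΩ x hcon] at hx
    linarith
  have hk : 0 < 1 - 3 * ε := by linarith
  have husupp : tsupport (fun x => (1 - 3 * ε)⁻¹ * v x) ⊆ tsupport v :=
    closure_mono fun x hx hx0 => hx (by simp [hx0])
  refine ⟨fun x => (1 - 3 * ε)⁻¹ * v x, ⟨contDiff_const.mul hvC, ?_, ?_, ?_⟩, fun x => ?_⟩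
  · refine isCompact_of_isClosed_isBounded (isClosed_tsupport _) (hΩ.subset ?_)
    exact (husupp.trans hvsupp).trans hsubΩ
  · exact (husupp.trans hvsupp).trans hsubΩ
  · intro x hx
    rw [mem_ofPred_eq] at hx
    change 1 ≤ (1 - 3 * ε)⁻¹ * v x
    rw [← div_eq_inv_mul, one_le_div hk]
    have h1 := (abs_le.1 (hvF x)).1
    have h2 : F x - ε ≤ F₀ x := le_max_left _ _
    linarith
  · have hdv : ‖fderiv ℝ v x‖ ≤ (1 + ε) * G x := by
      refine norm_fderiv_le_of_lip' ℝ (by positivity) ?_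
      filter_upwards [ball_mem_nhds x hδ0] with y hy
      refine φ.norm_normed_convolution_sub_le hF₀c fun t ht => ?_
      refine (hF₀F _ _).trans ?_
      have ht' : ‖t‖ < δ := by simpa using ht
      have hyx : dist (y - t) (x - t) = ‖y - x‖ := by rw [dist_sub_right, dist_eq_norm]
      rw [← hyx]
      refine (hFG (y - t) (x - t) (G x + L * ⟨2 * δ, by positivity⟩) fun z hz => ?_).trans ?_
      · have hzx : dist z x ≤ 2 * δ := by
          have hball : segment ℝ (y - t) (x - t) ⊆ closedBall x (2 * δ) := by
            refine (convex_closedBall x (2 * δ)).segment_subset ?_ ?_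
            · rw [mem_closedBall, dist_eq_norm]
              have h1 : ‖y - x‖ < δ := by rwa [← dist_eq_norm]
              calc ‖y - t - x‖ = ‖(y - x) - t‖ := by congr 1; abel
                _ ≤ ‖y - x‖ + ‖t‖ := norm_sub_le _ _
                _ ≤ 2 * δ := by linarith
            · rw [mem_closedBall, dist_eq_norm]
              simp only [sub_sub_cancel_left, norm_neg]
              linarith
          exact hball hz
        rw [← NNReal.coe_le_coe]
        push_cast
        have h1 := hG.dist_le_mul z x
        rw [NNReal.dist_eq] at h1
        have h2 : (L : ℝ) * dist z x ≤ L * (2 * δ) := by gcongr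
        have h3 := (abs_le.1 h1).2
        change (G z : ℝ) ≤ G x + L * (2 * δ)
        linarith
      · refine mul_le_mul_of_nonneg_right ?_ dist_nonneg
        change (G x : ℝ) + L * (2 * δ) ≤ _
        have : (c : ℝ) ≤ G x := by exact_mod_cast hcG x
        have := mul_le_mul_of_nonneg_left this hε.le
        linarith
    rw [fderiv_const_mul (hvC.differentiable (by simp) x), norm_smul, norm_inv, Real.norm_eq_abs,
      abs_of_pos hk, ← div_eq_inv_mul, div_mul_eq_mul_div]
    gcongr

/-! ### The lower bound -/

/-- `g` is admissible for `(A, Ω)`: every exit path from a point of `A` has cost at least `1`. -/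
def IsPathAdmissible {E : Type*} [NormedAddCommGroup E] (A Ω : Set E) (g : E → ℝ≥0∞) : Prop :=
  ∀ x ∈ A, ∀ γ T, IsExitPath Ω x γ T → 1 ≤ ∫⁻ t in Icc 0 T, g (γ t)

lemma IsPathAdmissible.mono {E : Type*} [NormedAddCommGroup E] {A Ω : Set E} {g h : E → ℝ≥0∞}
    (hg : IsPathAdmissible A Ω g) (hgh : ∀ x, g x ≤ h x) : IsPathAdmissible A Ω h :=
  fun x hx γ T hγ => (hg x hx γ T hγ).trans (lintegral_mono fun _ => hgh _)

/-- The exit cost truncated at height `1`. -/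
def truncExitCost {E : Type*} [NormedAddCommGroup E] (Ω : Set E) (g : E → ℝ≥0∞) (x : E) : ℝ :=
  (min 1 (exitCost Ω g x)).toReal

section TruncExitCost

variable {E : Type*} [NormedAddCommGroup E] {Ω : Set E}

lemma min_one_exitCost_ne_top (g : E → ℝ≥0∞) (x : E) : min 1 (exitCost Ω g x) ≠ ⊤ :=
  ((min_le_left _ _).trans_lt ENNReal.one_lt_top).ne

lemma ofReal_truncExitCost (g : E → ℝ≥0∞) (x : E) :
    ENNReal.ofReal (truncExitCost Ω g x) = min 1 (exitCost Ω g x) :=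
  ENNReal.ofReal_toReal (min_one_exitCost_ne_top g x)

lemma truncExitCost_eq_zero {x : E} (hx : x ∉ Ω) (g : E → ℝ≥0∞) : truncExitCost Ω g x = 0 := by
  simp [truncExitCost, exitCost_eq_zero hx]

lemma truncExitCost_mono {g h : E → ℝ≥0∞} (hgh : ∀ x, g x ≤ h x) (x : E) :
    truncExitCost Ω g x ≤ truncExitCost Ω h x :=
  ENNReal.toReal_mono (min_one_exitCost_ne_top h x) (min_le_min le_rfl (exitCost_mono hgh x))

lemma truncExitCost_sub_le [NormedSpace ℝ E] {g : E → ℝ≥0∞} {x y : E} {s : ℝ≥0}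
    (hs : ∀ z ∈ segment ℝ x y, g z ≤ s) :
    truncExitCost Ω g x - truncExitCost Ω g y ≤ s * dist x y := by
  rw [sub_le_iff_le_add]
  have h : min 1 (exitCost Ω g x) ≤ s * edist x y + min 1 (exitCost Ω g y) := by
    rw [← min_add_add_left]
    exact min_le_min le_add_self (exitCost_le_mul_edist_add hs)
  have hy := min_one_exitCost_ne_top (Ω := Ω) g y
  have := ENNReal.toReal_mono (by finiteness) h
  rwa [ENNReal.toReal_add (by finiteness) hy, ENNReal.toReal_mul,
    ← dist_edist] at this

lemma abs_truncExitCost_sub_le [NormedSpace ℝ E] {g : E → ℝ≥0∞} {x y : E} {s : ℝ≥0}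
    (hs : ∀ z ∈ segment ℝ x y, g z ≤ s) :
    |truncExitCost Ω g x - truncExitCost Ω g y| ≤ s * dist x y := by
  refine abs_sub_le_iff.2 ⟨truncExitCost_sub_le hs, ?_⟩
  rw [dist_comm]
  exact truncExitCost_sub_le (by rwa [segment_symm])

end TruncExitCost

lemma capHKM_le_of_lowerSemicontinuous {p : ℝ} (hp : 0 < p)
    {μ : Measure (EuclideanSpace ℝ (Fin n))} {A Ω : Set (EuclideanSpace ℝ (Fin n))}
    (hΩbdd : Bornology.IsBounded Ω) (hΩ : IsOpen Ω) (hA : A ⊆ Ω)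
    {g : EuclideanSpace ℝ (Fin n) → ℝ≥0∞} (hg : LowerSemicontinuous g) {c : ℝ≥0} (hc : 0 < c)
    (hcg : ∀ x, c ≤ g x) (hgA : IsPathAdmissible A Ω g) :
    capHKM p μ A Ω ≤ ∫⁻ x in Ω, g x ^ p ∂μ := by
  obtain ⟨G, hGL, hGM, hGm, hcG, hGg⟩ := exists_monotone_lipschitz_iSup_eq hg hcg
  set F : ℕ → EuclideanSpace ℝ (Fin n) → ℝ :=
    fun k => truncExitCost Ω fun x => (G k x : ℝ≥0∞) with hF
  have hFG : ∀ k x y, ∀ s : ℝ≥0, (∀ z ∈ segment ℝ x y, G k z ≤ s) →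
      |F k x - F k y| ≤ s * dist x y := fun k x y s hs =>
    abs_truncExitCost_sub_le fun z hz => ENNReal.coe_le_coe.2 (hs z hz)
  have hFc : ∀ k, Continuous (F k) := fun k =>
    (LipschitzWith.of_dist_le_mul (K := c + k) fun x y =>
      hFG k x y _ fun z _ => hGM k z).continuous
  have hFm : ∀ x, Monotone fun k => F k x := fun x i j hij =>
    truncExitCost_mono (fun y => ENNReal.coe_le_coe.2 (hGm hij y)) x
  have key : ∀ ε : ℝ, 0 < ε → 3 * ε < 1 → capHKM p μ A Ω ≤
      ENNReal.ofReal ((1 + ε) / (1 - 3 * ε)) ^ p * ∫⁻ x in Ω, g x ^ p ∂μ := by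
    intro ε hε hε3
    set V : ℕ → Set (EuclideanSpace ℝ (Fin n)) := fun k => {x | 1 - ε < F k x} with hV
    have hVo : ∀ k, IsOpen (V k) := fun k => isOpen_lt continuous_const (hFc k)
    have hVm : Monotone V := fun i j hij x hx => lt_of_lt_of_le hx (hFm x hij)
    have hAV : A ⊆ Ω ∩ ⋃ k, V k := by
      refine subset_inter hA fun x hx => ?_
      by_contra hcon
      simp only [mem_iUnion, not_exists, hV, mem_ofPred_eq, not_lt] at hcon
      have ha1 : (1 - ε / 2).toNNReal < 1 := by
        rw [← Real.toNNReal_one]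
        exact (Real.toNNReal_lt_toNNReal_iff one_pos).2 (by linarith)
      have hcost : ∀ k, exitCost Ω (fun y => (G k y : ℝ≥0∞)) x <
          ((1 - ε / 2).toNNReal : ℝ≥0∞) := by
        intro k
        have h1 : ENNReal.ofReal (F k x) < ((1 - ε / 2).toNNReal : ℝ≥0∞) :=
          (ENNReal.ofReal_lt_ofReal_iff (by linarith)).2 (by linarith [hcon k])
        rw [hF, ofReal_truncExitCost, min_lt_iff] at h1
        refine h1.resolve_left fun h2 => ?_
        exact absurd (ENNReal.coe_lt_one_iff.2 ha1) h2.not_gt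
      obtain ⟨γ, T, hγ, hle⟩ := exists_isExitPath_lintegral_iSup_le hΩ
        (fun k => (hGL k).continuous) hGm hc hcG hcost
      simp only [hGg] at hle
      exact absurd ((hgA x hx γ T hγ).trans hle) (not_le.2 (ENNReal.coe_lt_one_iff.2 ha1))
    refine (iInf₂_le (Ω ∩ ⋃ k, V k)
      ⟨hΩ.inter (isOpen_iUnion hVo), hAV, inter_subset_left⟩).trans ?_
    refine iSup₂_le fun K hK => ?_
    obtain ⟨k, hk⟩ := hK.1.elim_directed_cover V hVo (hK.2.trans inter_subset_right)
      hVm.directed_le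
    obtain ⟨u, hu, hbound⟩ := exists_isTestFunction_norm_fderiv_le hΩbdd
      (fun x hx => truncExitCost_eq_zero hx _) (hGL k) hc (hcG k) (M := c + k) (hGM k) (hFG k)
      hε hε3
    refine (capHKMCompact_le (hu.mono hk)).trans ?_
    rw [← lintegral_const_mul' _ _ (by finiteness)]
    refine lintegral_mono fun x => ?_
    rw [← ENNReal.mul_rpow_of_nonneg _ _ hp.le]
    refine ENNReal.rpow_le_rpow ?_ hp.le
    have h1 : (‖fderiv ℝ u x‖₊ : ℝ≥0∞) ≤ ENNReal.ofReal ((1 + ε) / (1 - 3 * ε) * G k x) := by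
      rw [← enorm_eq_nnnorm, ← ofReal_norm]
      exact ENNReal.ofReal_le_ofReal (hbound x)
    refine h1.trans ?_
    rw [ENNReal.ofReal_mul (div_nonneg (by linarith) (by linarith)), ENNReal.ofReal_coe_nnreal,
      ← hGg x]
    gcongr
    exact le_iSup (fun k => (G k x : ℝ≥0∞)) k
  have hlim : Tendsto (fun ε : ℝ => ENNReal.ofReal ((1 + ε) / (1 - 3 * ε)) ^ p *
      ∫⁻ x in Ω, g x ^ p ∂μ) (𝓝[>] 0) (𝓝 (∫⁻ x in Ω, g x ^ p ∂μ)) := by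
    have h1 : Tendsto (fun ε : ℝ => (1 + ε) / (1 - 3 * ε)) (𝓝 0) (𝓝 1) := by
      have : ContinuousAt (fun ε : ℝ => (1 + ε) / (1 - 3 * ε)) 0 :=
        ContinuousAt.div (by fun_prop) (by fun_prop) (by norm_num)
      simpa [ContinuousAt] using this
    have h2 := (ENNReal.continuous_rpow_const (y := p)).continuousAt.tendsto.comp
      (ENNReal.tendsto_ofReal (h1.mono_left (nhdsWithin_le_nhds (s := Ioi 0))))
    rw [ENNReal.ofReal_one, ENNReal.one_rpow] at h2
    have h3 := ENNReal.Tendsto.mul_const (b := ∫⁻ x in Ω, g x ^ p ∂μ) h2 (Or.inl one_ne_zero)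
    rwa [one_mul] at h3
  refine ge_of_tendsto hlim ?_
  filter_upwards [Ioo_mem_nhdsGT (show (0 : ℝ) < 1 / 3 by norm_num)] with ε hε
  exact key ε hε.1 (by linarith [hε.2])

lemma capHKM_le_of_measurable {p : ℝ} (hp : 0 < p)
    {μ : Measure (EuclideanSpace ℝ (Fin n))} {A Ω : Set (EuclideanSpace ℝ (Fin n))}
    (hΩbdd : Bornology.IsBounded Ω) (hΩ : IsOpen Ω) (hμΩ : μ Ω < ⊤) (hA : A ⊆ Ω)
    {g : EuclideanSpace ℝ (Fin n) → ℝ≥0∞} (hg : Measurable g) {c : ℝ≥0} (hc : 0 < c)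
    (hcg : ∀ x, c ≤ g x) (hgA : IsPathAdmissible A Ω g) :
    capHKM p μ A Ω ≤ ∫⁻ x in Ω, g x ^ p ∂μ := by
  have : IsFiniteMeasure (μ.restrict Ω) := isFiniteMeasure_restrict.2 hμΩ.ne
  refine ENNReal.le_of_forall_pos_le_add fun e he _ => ?_
  obtain ⟨h, hgh, hlsc, hle⟩ := exists_le_lowerSemicontinuous_lintegral_ge (μ.restrict Ω)
    (fun x => g x ^ p) (hg.pow_const p) (ε := e) (by exact_mod_cast he.ne')
  have hgh' : ∀ x, g x ≤ h x ^ p⁻¹ := fun x => (ENNReal.le_rpow_inv_iff hp).2 (hgh x)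
  refine le_trans ?_ hle
  refine (capHKM_le_of_lowerSemicontinuous hp hΩbdd hΩ hA (g := fun x => h x ^ p⁻¹)
    (ENNReal.continuous_rpow_const.comp_lowerSemicontinuous hlsc
      (ENNReal.monotone_rpow_of_nonneg (by positivity))) hc
    (fun x => (hcg x).trans (hgh' x)) (hgA.mono hgh')).trans_eq ?_
  simp only [ENNReal.rpow_inv_rpow hp.ne']

lemma one_le_ugDiff_zero {a : EReal} (ha : 1 ≤ a) : 1 ≤ ugDiff a 0 := by
  induction a with
  | bot => exact absurd (le_bot_iff.1 ha) (EReal.coe_ne_bot 1)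
  | top => simp [ugDiff]
  | coe r =>
    have hr : 1 ≤ r := by exact_mod_cast ha
    rw [← EReal.coe_zero, ugDiff_coe_s16, sub_zero, abs_of_nonneg (by linarith)]
    exact ENNReal.one_le_ofReal.2 hr

lemma isPathAdmissible_add {A Ω : Set (EuclideanSpace ℝ (Fin n))} (hA : A ⊆ Ω)
    {u : EuclideanSpace ℝ (Fin n) → EReal} (huΩ : ∀ x ∉ Ω, u x = 0) (huA : ∀ x ∈ A, 1 ≤ u x)
    {g ρ : EuclideanSpace ℝ (Fin n) → ℝ≥0∞} (hg : Measurable g) (hρ : Measurable ρ)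
    (hgρ : ∀ γ : Curve (EuclideanSpace ℝ (Fin n)), ¬ UGOn u g γ → γ.integral ρ = ⊤)
    {e : ℝ≥0} (he : 0 < e) :
    IsPathAdmissible A Ω fun x => g x + e * (ρ x + 1) := by
  intro x hx γ T ⟨hγ, hT, h0, hTΩ⟩
  have hne : γ 0 ≠ γ T := fun h => hTΩ (h ▸ h0.symm ▸ hA hx)
  obtain ⟨κ, hκ0, hκT, hκ⟩ := exists_curve_integral_le hγ hT hne
  refine le_trans ?_ (hκ _ (hg.add ((hρ.add_const 1).const_mul _)))
  by_cases h : UGOn u g κ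
  · rw [UGOn, hκ0, hκT, h0, huΩ _ hTΩ] at h
    exact (one_le_ugDiff_zero (huA x hx)).trans
      (h.trans (lintegral_mono fun t => le_self_add))
  · have htop : (e : ℝ≥0∞) * κ.integral ρ = ⊤ := by
      rw [hgρ κ h, ENNReal.mul_top (by exact_mod_cast he.ne')]
    rw [Curve.integral, ← lintegral_const_mul' _ _ ENNReal.coe_ne_top] at htop
    refine le_top.trans (htop.ge.trans (lintegral_mono fun t => ?_))
    calc (e : ℝ≥0∞) * ρ (κ.toFun t) ≤ e * (ρ (κ.toFun t) + 1) := by gcongr; exact le_self_add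
      _ ≤ _ := le_add_self

lemma capHKM_le_varCapacity {p : ℝ} (hp : 1 < p)
    {μ : Measure (EuclideanSpace ℝ (Fin n))} {A Ω : Set (EuclideanSpace ℝ (Fin n))}
    (hΩbdd : Bornology.IsBounded Ω) (hΩ : IsOpen Ω) (hμΩ : μ Ω < ⊤) (hA : A ⊆ Ω) :
    capHKM p μ A Ω ≤ varCapacity p μ A Ω := by
  have hp0 : 0 < p := by linarith
  refine le_iInf₂ fun u hu => le_iInf₂ fun g hg => ?_
  obtain ⟨hgm, ρ, hρm, hρfin, hρ⟩ := hg
  set I : ℝ≥0∞ := ∫⁻ x in Ω, g x ^ p ∂μ with hI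
  set J : ℝ≥0∞ := ∫⁻ x in Ω, (ρ x + 1) ^ p ∂μ with hJ
  refine le_trans ?_ (setLIntegral_le_lintegral Ω fun x => g x ^ p)
  rw [← hI]
  have hJfin : J < ⊤ := by
    refine ENNReal.lintegral_rpow_add_lt_top_of_lintegral_rpow_lt_top (g := fun _ => 1)
      hρm.aemeasurable ((setLIntegral_le_lintegral Ω _).trans_lt hρfin) ?_ hp.le
    simpa using hμΩ
  have key : ∀ e : ℝ≥0, 0 < e →
      capHKM p μ A Ω ^ (1 / p) ≤ I ^ (1 / p) + e * J ^ (1 / p) := by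
    intro e he
    have h1 := capHKM_le_of_measurable (μ := μ) hp0 hΩbdd hΩ hμΩ hA
      (hgm.add ((hρm.add_const 1).const_mul (e : ℝ≥0∞))) he
      (fun x => le_add_left (by
        calc (e : ℝ≥0∞) = e * 1 := (mul_one _).symm
          _ ≤ e * (ρ x + 1) := by gcongr; exact le_add_self))
      (isPathAdmissible_add hA hu.1.2 hu.2 hgm hρm (fun γ hγ => hρ γ hγ) he)
    refine (ENNReal.rpow_le_rpow h1 (by positivity)).trans ?_
    refine (ENNReal.lintegral_Lp_add_le hgm.aemeasurable
      ((hρm.add_const 1).const_mul (e : ℝ≥0∞)).aemeasurable hp.le).trans_eq ?_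
    congr 1
    simp only [ENNReal.mul_rpow_of_nonneg _ _ hp0.le]
    rw [lintegral_const_mul' _ _ (by finiteness),
      ENNReal.mul_rpow_of_nonneg _ _ (by positivity), one_div, ENNReal.rpow_rpow_inv hp0.ne']
  rw [← ENNReal.rpow_le_rpow_iff (z := 1 / p) (by positivity)]
  have hlim : Tendsto (fun e : ℝ≥0 => I ^ (1 / p) + e * J ^ (1 / p)) (𝓝[>] 0)
      (𝓝 (I ^ (1 / p))) := by
    have h1 : Tendsto (fun e : ℝ≥0 => (e : ℝ≥0∞)) (𝓝[>] 0) (𝓝 0) :=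
      (ENNReal.continuous_coe.tendsto 0).mono_left nhdsWithin_le_nhds
    have h2 := (ENNReal.Tendsto.mul_const (b := J ^ (1 / p)) h1
      (Or.inr (by finiteness))).const_add (I ^ (1 / p))
    rwa [zero_mul, add_zero] at h2
  exact ge_of_tendsto hlim (eventually_nhdsWithin_of_forall fun e he => key e he)

/-- On `ℝⁿ` equipped with a `p`-admissible weight `w`, `p > 1`, and a
nonempty bounded open set `Ω`, the Newtonian variational capacity `cap_p(A,Ω)`
coincides with the Heinonen–Kilpeläinen–Martio variational capacity `cap_{p,μ}(A,Ω)`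
for every `A ⊆ Ω`, where `dμ = w dx`. -/
theorem stmt_16 (p : ℝ) (hp : 1 < p) (w : EuclideanSpace ℝ (Fin n) → ℝ≥0∞)
    (hw : IsPAdmissibleWeight p w)
    (Ω : Set (EuclideanSpace ℝ (Fin n))) (hΩne : Ω.Nonempty)
    (hΩbdd : Bornology.IsBounded Ω) (hΩopen : IsOpen Ω)
    (A : Set (EuclideanSpace ℝ (Fin n))) (hA : A ⊆ Ω) :
    varCapacity p (volume.withDensity w) A Ω = capHKM p (volume.withDensity w) A Ω := by
  have hμΩ : volume.withDensity w Ω < ⊤ := by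
    obtain ⟨C, hC⟩ := hw.2.1
    obtain ⟨r, hr, hsub⟩ := hΩbdd.subset_ball_lt 0 0
    exact (measure_mono hsub).trans_lt (hC 0 r hr).2.2
  exact le_antisymm
    (le_iInf₂ fun G hG => varCapacity_le_capHKMOpen hp hΩbdd hΩopen hμΩ hG.1 hG.2.2 hG.2.1)
    (capHKM_le_varCapacity hp hΩbdd hΩopen hμΩ hA)

end
end

section
/- Inner regularity of ~cap_p on decreasing compact sets: if K_1 ⊃ K_2 ⊃ ⋯ are compact subsets of E and K = ⋂_{j=1}^∞ K_j, then ~cap_p(K, E) = lim_{j→∞} ~cap_p(K_j, E). (No quasicontinuity or other additional assumptions on X are needed.) -/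
open MeasureTheory Metric Set Filter
open scoped ENNReal NNReal Topology

noncomputable section

variable {X : Type*} [MetricSpace X] [MeasurableSpace X] [BorelSpace X]

/-- The capacity `~cap_p(·, E)` is monotone. -/
theorem varCapacityT_mono (p : ℝ) (μ : Measure X) {A B : Set X} (hAB : A ⊆ B) (E : Set X) :
    varCapacityT p μ A E ≤ varCapacityT p μ B E :=
  le_iInf₂ fun G hG => iInf₂_le G ⟨hAB.trans hG.1, hG.2⟩

/-- Inner regularity of `~cap_p` on decreasing sequences of compact
subsets of `E`; no additional assumptions on `X`. -/
theorem stmt_17 (p : ℝ) (hp : 1 ≤ p) (μ : Measure X)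
    (hball : ∀ (x : X) (r : ℝ), 0 < r → 0 < μ (Metric.ball x r) ∧ μ (Metric.ball x r) < ⊤)
    (E : Set X) (hE : Bornology.IsBounded E)
    (K : ℕ → Set X) (hK : ∀ j, IsCompact (K j)) (hKE : ∀ j, K j ⊆ E)
    (hmono : ∀ j, K (j + 1) ⊆ K j) :
    Filter.Tendsto (fun j => varCapacityT p μ (K j) E) Filter.atTop
      (𝓝 (varCapacityT p μ (⋂ j, K j) E)) := by
  have hanti : Antitone K := antitone_nat_of_succ_le hmono
  have hlim : ⨅ j, varCapacityT p μ (K j) E = varCapacityT p μ (⋂ j, K j) E := by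
    refine le_antisymm (le_iInf₂ ?_)
      (le_iInf fun j => varCapacityT_mono p μ (iInter_subset K j) E)
    rintro G ⟨hKG, hGE, U, hU, rfl⟩
    obtain ⟨j, hj⟩ := exists_subset_nhds_of_isCompact hanti.directed_ge hK
      fun x hx => hU.mem_nhds (hKG hx).1
    exact iInf_le_of_le j (iInf₂_le (U ∩ E) ⟨subset_inter hj (hKE j), hGE, U, hU, rfl⟩)
  rw [← hlim]
  exact tendsto_atTop_iInf fun i j hij => varCapacityT_mono p μ (hanti hij) E

end
end
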